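/- arXiv:2208.12435 — 8 statements merged into one kernel-verified Lean document; each statement's English description precedes it below -/
import Mathlib

section
/- Let X_1, …, X_{n+1} be exchangeable real-valued random variables on a probability space. Then for every α ∈ [0,1], P( (1/(n+1)) ( Σ_{i=1}^{n} 1{X_{n+1} ≤ X_i} + 1 ) ≤ α ) ≤ ⌊(n+1)α⌋/(n+1) ≤ α, where ⌊x⌋ denotes the largest integer smaller than or equal to x. -/
open MeasureTheory

/-- A finite family of real-valued random variables is *exchangeable* if for every
permutation `σ` of the index set, `(X_{σ(1)}, …, X_{σ(m)})` has the same joint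
distribution as `(X_1, …, X_m)`. -/
def Exchangeable {Ω : Type*} [MeasurableSpace Ω] (P : Measure Ω) {m : ℕ}
    (X : Fin m → Ω → ℝ) : Prop :=
  ∀ σ : Equiv.Perm (Fin m),
    Measure.map (fun ω (i : Fin m) => X (σ i) ω) P
      = Measure.map (fun ω (i : Fin m) => X i ω) P

lemma rank_card_le {N : ℕ} (x : Fin N → ℝ) (m : ℕ) :
    (Finset.univ.filter (fun k : Fin N =>
      (Finset.univ.filter (fun i : Fin N => x k ≤ x i)).card ≤ m)).card ≤ m := by
  set S := Finset.univ.filter (fun k : Fin N =>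
      (Finset.univ.filter (fun i : Fin N => x k ≤ x i)).card ≤ m) with hS
  rcases S.eq_empty_or_nonempty with h | h
  · simp [h]
  · obtain ⟨k, hk, hmin⟩ := S.exists_min_image x h
    have hk2 : (Finset.univ.filter (fun i : Fin N => x k ≤ x i)).card ≤ m := by
      simpa [hS] using hk
    refine le_trans (Finset.card_le_card ?_) hk2
    intro i hi
    simpa using hmin i hi

lemma rank_measurable {N : ℕ} (k : Fin N) (m : ℕ) :
    MeasurableSet {x : Fin N → ℝ | (Finset.univ.filter (fun i : Fin N => x k ≤ x i)).card ≤ m} := by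
  have h : Measurable (fun x : Fin N → ℝ => ∑ i : Fin N, if x k ≤ x i then (1 : ℕ) else 0) := by
    refine Finset.measurable_sum _ (fun i _ => ?_)
    exact Measurable.ite (measurableSet_le (measurable_pi_apply k) (measurable_pi_apply i))
      measurable_const measurable_const
  simp only [Finset.card_filter]
  exact h measurableSet_Iic

lemma rank_prob {Ω : Type*} [MeasurableSpace Ω]
    (P : Measure Ω) [IsProbabilityMeasure P] {n : ℕ}
    (X : Fin (n + 1) → Ω → ℝ) (hmeas : ∀ i, Measurable (X i))
    (hexch : Exchangeable P X) (m : ℕ) :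
    ((n : ℝ) + 1) * P.real {ω | (Finset.univ.filter
      (fun i => X (Fin.last n) ω ≤ X i ω)).card ≤ m} ≤ m := by
  have hm : ∀ k, MeasurableSet {ω | (Finset.univ.filter (fun i => X k ω ≤ X i ω)).card ≤ m} :=
    fun k => (measurable_pi_lambda (fun ω i => X i ω) hmeas) (rank_measurable k m)
  have heq : ∀ k, P.real {ω | (Finset.univ.filter (fun i => X k ω ≤ X i ω)).card ≤ m} =
      P.real {ω | (Finset.univ.filter (fun i => X (Fin.last n) ω ≤ X i ω)).card ≤ m} := by
    intro k
    have h := congrArg (fun ν => ν {x : Fin (n + 1) → ℝ | (Finset.univ.filter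
      (fun i => x (Fin.last n) ≤ x i)).card ≤ m}) (hexch (Equiv.swap (Fin.last n) k))
    rw [Measure.map_apply (measurable_pi_lambda _ (fun i => hmeas _)) (rank_measurable _ m),
      Measure.map_apply (measurable_pi_lambda _ hmeas) (rank_measurable _ m)] at h
    simp only [Set.preimage_setOf_eq, Equiv.swap_apply_left] at h
    rw [measureReal_def, measureReal_def, ← h]
    congr 2
    ext ω
    simp only [Set.mem_setOf_eq, Finset.card_filter]
    rw [Equiv.sum_comp (Equiv.swap (Fin.last n) k) (fun i => if X k ω ≤ X i ω then 1 else 0)]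
  calc ((n : ℝ) + 1) * P.real {ω | (Finset.univ.filter
      (fun i => X (Fin.last n) ω ≤ X i ω)).card ≤ m}
      = ∑ k : Fin (n + 1), P.real {ω | (Finset.univ.filter
          (fun i => X k ω ≤ X i ω)).card ≤ m} := by
        simp [heq]
    _ = ∑ k : Fin (n + 1), ∫ ω, Set.indicator {ω | (Finset.univ.filter
          (fun i => X k ω ≤ X i ω)).card ≤ m} (fun _ => (1 : ℝ)) ω ∂P := by
        refine Finset.sum_congr rfl (fun k _ => ?_)
        rw [integral_indicator_const _ (hm k)]
        simp
    _ = ∫ ω, ∑ k : Fin (n + 1), Set.indicator {ω | (Finset.univ.filter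
          (fun i => X k ω ≤ X i ω)).card ≤ m} (fun _ => (1 : ℝ)) ω ∂P := by
        rw [integral_finset_sum]
        exact fun k _ => (integrable_const _).indicator (hm k)
    _ ≤ ∫ _, (m : ℝ) ∂P := by
        refine integral_mono (integrable_finset_sum _
          fun k _ => (integrable_const _).indicator (hm k)) (integrable_const _) (fun ω => ?_)
        have := rank_card_le (fun i => X i ω) m
        rw [Finset.card_filter] at this
        simp only [Set.indicator_apply, Set.mem_setOf_eq]
        exact_mod_cast this
    _ = m := by simp

/-- For exchangeable random variables `X_1, …, X_{n+1}`, the permutation p-value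
`(1/(n+1)) (∑_{i=1}^n 1{X_{n+1} ≤ X_i} + 1)` satisfies
`P(p-value ≤ α) ≤ ⌊(n+1)α⌋/(n+1) ≤ α` for every `α ∈ [0,1]`. -/
theorem permutation_pvalue_bound {Ω : Type*} [MeasurableSpace Ω]
    (P : Measure Ω) [IsProbabilityMeasure P] {n : ℕ}
    (X : Fin (n + 1) → Ω → ℝ) (hmeas : ∀ i, Measurable (X i))
    (hexch : Exchangeable P X) :
    ∀ α ∈ Set.Icc (0 : ℝ) 1,
      (P {ω | (1 / ((n : ℝ) + 1)) *
            ((∑ i : Fin n, if X (Fin.last n) ω ≤ X i.castSucc ω then (1 : ℝ) else 0) + 1)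
          ≤ α}).toReal
        ≤ (⌊((n : ℝ) + 1) * α⌋ : ℝ) / ((n : ℝ) + 1)
      ∧ (⌊((n : ℝ) + 1) * α⌋ : ℝ) / ((n : ℝ) + 1) ≤ α := by
  intro α hα
  have hn : (0 : ℝ) < (n : ℝ) + 1 := by positivity
  have h0 : 0 ≤ ((n : ℝ) + 1) * α := mul_nonneg hn.le hα.1
  constructor
  · rw [le_div_iff₀ hn, mul_comm, ← natCast_floor_eq_intCast_floor h0]
    refine le_trans (le_of_eq ?_) (rank_prob P X hmeas hexch ⌊((n : ℝ) + 1) * α⌋₊)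
    rw [measureReal_def]
    congr 3
    ext ω
    simp only [Set.mem_setOf_eq]
    rw [Nat.le_floor_iff h0, Finset.card_filter, Fin.sum_univ_castSucc, one_div,
      inv_mul_le_iff₀ hn]
    simp
  · rw [div_le_iff₀ hn, mul_comm α]
    exact Int.floor_le _
end

section
/- Let X_1, …, X_{n+1} be exchangeable real-valued random variables on a probability space such that, with probability one, X_1, …, X_{n+1} are pairwise distinct. Then for every α ∈ [0,1], P( (1/(n+1)) ( Σ_{i=1}^{n} 1{X_{n+1} ≤ X_i} + 1 ) ≤ α ) = ⌊(n+1)α⌋/(n+1), where ⌊x⌋ denotes the largest integer smaller than or equal to x. -/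
open MeasureTheory

/-- Upper rank of coordinate `j`. -/
noncomputable def uRank {m : ℕ} (x : Fin m → ℝ) (j : Fin m) : ℕ :=
  (Finset.univ.filter fun i => x j ≤ x i).card

lemma uRank_lt {m : ℕ} (x : Fin m → ℝ) {a b : Fin m} (h : x a < x b) :
    uRank x b < uRank x a := by
  apply Finset.card_lt_card
  rw [Finset.ssubset_iff_of_subset]
  · exact ⟨a, by simp, by simpa using h⟩
  · intro i hi
    simp only [Finset.mem_filter, Finset.mem_univ, true_and] at hi ⊢
    exact h.le.trans hi

lemma uRank_inj {m : ℕ} (x : Fin m → ℝ) (hx : Function.Injective x) :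
    Function.Injective (uRank x) := by
  intro a b hab
  rcases lt_trichotomy (x a) (x b) with h | h | h
  · have := uRank_lt x h; omega
  · exact hx h
  · have := uRank_lt x h; omega

lemma uRank_count {m : ℕ} (x : Fin m → ℝ) (hx : Function.Injective x) {k : ℕ} (hk : k ≤ m) :
    (Finset.univ.filter fun j => uRank x j ≤ k).card = k := by
  have hpos : ∀ j, 1 ≤ uRank x j := fun j => Finset.card_pos.mpr ⟨j, by simp⟩
  have hle : ∀ j, uRank x j ≤ m := fun j => by
    simpa [uRank] using Finset.card_filter_le (Finset.univ : Finset (Fin m)) (fun i => x j ≤ x i)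
  have himg : Finset.univ.image (uRank x) = Finset.Icc 1 m := by
    apply Finset.eq_of_subset_of_card_le
    · intro r hr
      simp only [Finset.mem_image, Finset.mem_univ, true_and] at hr
      obtain ⟨j, rfl⟩ := hr
      exact Finset.mem_Icc.mpr ⟨hpos j, hle j⟩
    · rw [Finset.card_image_of_injective _ (uRank_inj x hx)]; simp
  have h2 : (Finset.univ.filter fun j => uRank x j ≤ k).image (uRank x) = Finset.Icc 1 k := by
    ext r
    simp only [Finset.mem_image, Finset.mem_filter, Finset.mem_univ, true_and, Finset.mem_Icc]
    constructor
    · rintro ⟨j, hj, rfl⟩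
      exact ⟨hpos j, hj⟩
    · rintro ⟨h1, h3⟩
      have : r ∈ Finset.univ.image (uRank x) := by
        rw [himg]; exact Finset.mem_Icc.mpr ⟨h1, h3.trans hk⟩
      simp only [Finset.mem_image, Finset.mem_univ, true_and] at this
      obtain ⟨j, rfl⟩ := this
      exact ⟨j, h3, rfl⟩
  rw [← Finset.card_image_of_injective _ (uRank_inj x hx), h2]; simp

lemma measurable_uRank {m : ℕ} (j : Fin m) : Measurable fun x : Fin m → ℝ => uRank x j := by
  unfold uRank
  simp only [Finset.card_filter]
  refine Finset.measurable_sum _ fun i _ => ?_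
  exact Measurable.ite (measurableSet_le (measurable_pi_apply j) (measurable_pi_apply i))
    measurable_const measurable_const

lemma uRank_perm {m : ℕ} (x : Fin m → ℝ) (σ : Equiv.Perm (Fin m)) (j : Fin m) :
    uRank (fun i => x (σ i)) j = uRank x (σ j) := by
  unfold uRank
  simp only [Finset.card_filter]
  exact Equiv.sum_comp σ (fun i => if x (σ j) ≤ x i then 1 else 0)

/-- For exchangeable random variables `X_1, …, X_{n+1}` that are almost surely pairwise
distinct, the permutation p-value `(1/(n+1)) (∑_{i=1}^n 1{X_{n+1} ≤ X_i} + 1)` satisfies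
`P(p-value ≤ α) = ⌊(n+1)α⌋/(n+1)` for every `α ∈ [0,1]`. -/
theorem permutation_pvalue_exact {Ω : Type*} [MeasurableSpace Ω]
    (P : Measure Ω) [IsProbabilityMeasure P] {n : ℕ}
    (X : Fin (n + 1) → Ω → ℝ) (hmeas : ∀ i, Measurable (X i))
    (hexch : Exchangeable P X)
    (hdistinct : ∀ᵐ ω ∂P, Function.Injective fun i => X i ω) :
    ∀ α ∈ Set.Icc (0 : ℝ) 1,
      (P {ω | (1 / ((n : ℝ) + 1)) *
            ((∑ i : Fin n, if X (Fin.last n) ω ≤ X i.castSucc ω then (1 : ℝ) else 0) + 1)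
          ≤ α}).toReal
        = (⌊((n : ℝ) + 1) * α⌋ : ℝ) / ((n : ℝ) + 1) := by
  intro α hα
  have hn : (0 : ℝ) < (n : ℝ) + 1 := by positivity
  set k := ⌊((n : ℝ) + 1) * α⌋₊ with hkdef
  have h0 : 0 ≤ ((n : ℝ) + 1) * α := mul_nonneg hn.le hα.1
  have hk : k ≤ n + 1 := by
    apply Nat.floor_le_of_le
    push_cast
    nlinarith [hα.2]
  have hfl : ((⌊((n : ℝ) + 1) * α⌋ : ℤ) : ℝ) = (k : ℝ) := by
    rw [hkdef, natCast_floor_eq_intCast_floor h0]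
  let A : Fin (n + 1) → Set Ω := fun j => {ω | uRank (fun i => X i ω) j ≤ k}
  have hXm : Measurable fun ω (i : Fin (n + 1)) => X i ω := measurable_pi_lambda _ hmeas
  have hS : ∀ j, MeasurableSet {x : Fin (n + 1) → ℝ | uRank x j ≤ k} := fun j =>
    measurable_uRank j measurableSet_Iic
  have hA : ∀ j, MeasurableSet (A j) := fun j => hXm (hS j)
  have hev : {ω | (1 / ((n : ℝ) + 1)) *
            ((∑ i : Fin n, if X (Fin.last n) ω ≤ X i.castSucc ω then (1 : ℝ) else 0) + 1)
          ≤ α} = A (Fin.last n) := by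
    ext ω
    have hr : (∑ i : Fin n, if X (Fin.last n) ω ≤ X i.castSucc ω then (1 : ℝ) else 0) + 1
        = (uRank (fun i => X i ω) (Fin.last n) : ℝ) := by
      unfold uRank
      rw [Finset.card_filter, Fin.sum_univ_castSucc]
      push_cast
      simp
    simp only [Set.mem_ofPred_eq, A]
    rw [hr, hkdef, Nat.le_floor_iff h0, one_div, inv_mul_le_iff₀ hn]
  have hex : ∀ j, P (A j) = P (A (Fin.last n)) := by
    intro j
    have h := congrArg (fun ν => ν {x : Fin (n + 1) → ℝ | uRank x (Fin.last n) ≤ k})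
      (hexch (Equiv.swap (Fin.last n) j))
    rw [Measure.map_apply (measurable_pi_lambda _ fun i => hmeas _) (hS _),
      Measure.map_apply hXm (hS _)] at h
    rw [show A (Fin.last n) = _ from rfl]
    refine Eq.trans ?_ h
    congr 1
    ext ω
    simp only [A, Set.mem_ofPred_eq, Set.mem_preimage]
    rw [uRank_perm (fun i => X i ω), Equiv.swap_apply_left]
  have hsum : ∑ j, P (A j) = k := by
    calc ∑ j, P (A j) = ∑ j, ∫⁻ ω, (A j).indicator 1 ω ∂P := by
          simp_rw [lintegral_indicator_one (hA _)]
      _ = ∫⁻ ω, ∑ j, (A j).indicator 1 ω ∂P := by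
          rw [lintegral_finsetSum]
          exact fun j _ => measurable_one.indicator (hA j)
      _ = ∫⁻ _, (k : ENNReal) ∂P := by
          apply lintegral_congr_ae
          filter_upwards [hdistinct] with ω hω
          have := uRank_count _ hω hk
          rw [Finset.card_filter] at this
          conv_rhs => rw [← this]
          push_cast
          simp [A, Set.indicator_apply]
      _ = k := by simp
  simp only [hex, Finset.sum_const, Finset.card_univ, Fintype.card_fin, nsmul_eq_mul] at hsum
  have h3 := congrArg ENNReal.toReal hsum
  rw [ENNReal.toReal_mul, ENNReal.toReal_natCast, ENNReal.toReal_natCast] at h3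
  push_cast at h3
  rw [hev, hfl, eq_div_iff hn.ne', mul_comm]
  exact h3
end

section
/- Let (X, δ) be a metric space. Then (X, δ) has negative type if and only if for all pairs of Borel probability measures μ, ν on X with finite first moments, the energy distance satisfies E(μ, ν) = 2∫∫ δ(x,y) dμ(x)dν(y) − ∫∫ δ(x,x') dμ(x)dμ(x') − ∫∫ δ(y,y') dν(y)dν(y') ≥ 0. -/
open MeasureTheory

/-- A metric space has *negative type* if for every `n`, all points `x_1, …, x_n` and all
real coefficients `α_1, …, α_n` summing to zero, `∑_i ∑_j α_i α_j δ(x_i, x_j) ≤ 0`. -/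
def HasNegativeType (X : Type*) [MetricSpace X] : Prop :=
  ∀ (n : ℕ) (x : Fin n → X) (a : Fin n → ℝ), (∑ i, a i) = 0 →
    ∑ i, ∑ j, a i * a j * dist (x i) (x j) ≤ 0

/-- A Borel probability measure has *finite first moment* if `∫ δ(x, x₀) dμ(x) < ∞` for
some point `x₀`. -/
def FiniteFirstMoment {X : Type*} [MetricSpace X] [MeasurableSpace X]
    (μ : Measure X) : Prop :=
  ∃ x₀ : X, Integrable (fun x => dist x x₀) μ

/-- The energy distance
`E(μ,ν) = 2∫∫ δ(x,y) dμ dν − ∫∫ δ(x,x') dμ dμ − ∫∫ δ(y,y') dν dν`. -/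
noncomputable def energyDistance {X : Type*} [MetricSpace X] [MeasurableSpace X]
    (μ ν : Measure X) : ℝ :=
  2 * ∫ x, ∫ y, dist x y ∂ν ∂μ
    - ∫ x, ∫ x', dist x x' ∂μ ∂μ
    - ∫ y, ∫ y', dist y y' ∂ν ∂ν


lemma HasNegativeType.fintype {X : Type*} [MetricSpace X] (h : HasNegativeType X)
    {ι : Type*} [Fintype ι] (x : ι → X) (a : ι → ℝ) (ha : ∑ i, a i = 0) :
    ∑ i, ∑ j, a i * a j * dist (x i) (x j) ≤ 0 := by
  let e := (Fintype.equivFin ι).symm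
  have := h _ (x ∘ e) (a ∘ e) (by simpa using (e.sum_comp a).trans ha)
  simp only [Function.comp_apply] at this
  rw [← e.sum_comp]
  simp_rw [← e.sum_comp (fun j => a _ * a j * dist (x _) (x j))]
  exact this

/-- The positive semidefinite kernel. -/
noncomputable def ntK {X : Type*} [MetricSpace X] (x₀ : X) : Matrix X X (ℝ →L[ℝ] ℝ) :=
  fun x y => (dist x x₀ + dist y x₀ - dist x y) • ContinuousLinearMap.id ℝ ℝ

lemma ntK_posSemidef {X : Type*} [MetricSpace X] (h : HasNegativeType X) (x₀ : X) :
    (ntK x₀).PosSemidef := by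
  have T := (RKHS.posSemidef_tfae (K := ntK x₀)).out 0 2
  refine T.mpr ⟨?_, fun v => ?_⟩
  · ext x y
    have e : star (ContinuousLinearMap.id ℝ ℝ) = ContinuousLinearMap.id ℝ ℝ :=
      star_one (ℝ →L[ℝ] ℝ)
    simp [ntK, Matrix.conjTranspose_apply, dist_comm y x, add_comm, e]
  · have key := h.fintype (ι := Option v.support)
      (fun o => o.elim x₀ (fun i => (i : X)))
      (fun o => o.elim (-∑ i : v.support, v i) (fun i => v i)) (by simp [Fintype.sum_option])
    simp only [Fintype.sum_option, Option.elim, dist_self, mul_zero, zero_add] at key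
    simp only [RCLike.re_to_real, Finsupp.sum, ntK]
    rw [← Finset.sum_coe_sort]
    simp_rw [← Finset.sum_coe_sort v.support (fun j => inner ℝ _ _)]
    simp only [smul_apply, ContinuousLinearMap.id_apply, RCLike.inner_apply, conj_trivial, smul_eq_mul]
    set S := ∑ i : v.support, v i
    have e1 : ∑ i : v.support, ∑ j : v.support,
        v j * ((dist (j:X) x₀ + dist (i:X) x₀ - dist (j:X) (i:X)) * v i)
        = S * (∑ j : v.support, v j * dist (j : X) x₀) + S * (∑ j : v.support, v j * dist (j : X) x₀)
          - ∑ i : v.support, ∑ j : v.support, v i * v j * dist (i : X) (j : X) := by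
      nth_rewrite 2 [mul_comm]
      simp only [S, Finset.sum_mul_sum]
      simp only [← Finset.sum_add_distrib, ← Finset.sum_sub_distrib]
      refine Finset.sum_congr rfl fun i _ => Finset.sum_congr rfl fun j _ => ?_
      rw [dist_comm (j : X) i]; ring
    have e2 : ∑ j : v.support, -S * v j * dist x₀ (j : X) = -(S * (∑ j : v.support, v j * dist (j : X) x₀)) := by
      rw [Finset.mul_sum, ← Finset.sum_neg_distrib (f := fun i : v.support => S * (v i * dist (i : X) x₀))]
      refine Finset.sum_congr rfl fun j _ => ?_
      rw [dist_comm x₀]; ring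
    have e3 : ∑ j : v.support, v j * -S * dist (j : X) x₀ = -(S * (∑ j : v.support, v j * dist (j : X) x₀)) := by
      rw [Finset.mul_sum, ← Finset.sum_neg_distrib (f := fun i : v.support => S * (v i * dist (i : X) x₀))]
      refine Finset.sum_congr rfl fun j _ => ?_
      ring
    rw [Finset.sum_add_distrib, e2, e3] at key
    rw [e1]
    linarith

lemma pettis {X : Type*} [TopologicalSpace X] [MeasurableSpace X] [BorelSpace X]
    {H : Type*} [NormedAddCommGroup H] [InnerProductSpace ℝ H] [CompleteSpace H]
    (φ : X → H) (hφ : Continuous φ) (μ : Measure X) (hi : Integrable (fun x => ‖φ x‖) μ) :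
    ∃ m : H, ∀ v : H, Integrable (fun x => inner ℝ v (φ x)) μ ∧
      ∫ x, inner ℝ v (φ x) ∂μ = inner ℝ v m := by
  have hint : ∀ v : H, Integrable (fun x => inner ℝ v (φ x)) μ := fun v => by
    refine (hi.const_mul ‖v‖).mono' ?_ (ae_of_all _ fun x => norm_inner_le_norm _ _)
    exact (continuous_const.inner hφ).measurable.aestronglyMeasurable
  let L : H →ₗ[ℝ] ℝ :=
    { toFun := fun v => ∫ x, inner ℝ v (φ x) ∂μ
      map_add' := fun v w => by
        simp only [inner_add_left]
        exact integral_add (hint v) (hint w)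
      map_smul' := fun c v => by
        simp only [real_inner_smul_left, RingHom.id_apply, smul_eq_mul]
        exact integral_const_mul _ _ }
  let L' : H →L[ℝ] ℝ := L.mkContinuous (∫ x, ‖φ x‖ ∂μ) fun v => by
    refine (norm_integral_le_of_norm_le (hi.const_mul ‖v‖)
      (ae_of_all _ fun x => norm_inner_le_norm _ _)).trans ?_
    rw [integral_const_mul, mul_comm]
  refine ⟨(InnerProductSpace.toDual ℝ H).symm L', fun v => ⟨hint v, ?_⟩⟩
  rw [real_inner_comm, InnerProductSpace.toDual_symm_apply]
  rfl

universe u in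
lemma exists_embedding {X : Type u} [MetricSpace X] (h : HasNegativeType X) (x₀ : X) :
    ∃ (H : Type u) (_ : NormedAddCommGroup H) (_ : InnerProductSpace ℝ H) (_ : CompleteSpace H)
      (φ : X → H), ∀ x y, inner ℝ (φ x) (φ y) = dist x x₀ + dist y x₀ - dist x y := by
  have : Fact (ntK x₀).PosSemidef := ⟨ntK_posSemidef h x₀⟩
  refine ⟨RKHS.OfKernel (ntK x₀), inferInstance, inferInstance, inferInstance,
    fun x => RKHS.kerFun (RKHS.OfKernel (ntK x₀)) x 1, fun x y => ?_⟩
  rw [← RKHS.kernel_inner, RKHS.OfKernel.kernel_ofKernel]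
  simp [ntK, dist_comm y x]
  ring

lemma FiniteFirstMoment.integrable {X : Type*} [MetricSpace X] [MeasurableSpace X] [BorelSpace X]
    {μ : Measure X} [IsProbabilityMeasure μ] (h : FiniteFirstMoment μ) (x₀ : X) :
    Integrable (fun x => dist x x₀) μ := by
  obtain ⟨x₁, h₁⟩ := h
  refine (h₁.add (integrable_const (dist x₁ x₀))).mono' ?_ (ae_of_all _ fun x => ?_)
  · exact (continuous_id.dist continuous_const).measurable.aestronglyMeasurable
  · rw [Real.norm_of_nonneg dist_nonneg]
    exact dist_triangle _ _ _

lemma energy_nonneg {X : Type*} [MetricSpace X] [MeasurableSpace X] [BorelSpace X]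
    (h : HasNegativeType X) (μ ν : Measure X) [IsProbabilityMeasure μ] [IsProbabilityMeasure ν]
    (hμ : FiniteFirstMoment μ) (hν : FiniteFirstMoment ν) : 0 ≤ energyDistance μ ν := by
  obtain ⟨x₀, -⟩ := id hμ
  obtain ⟨H, _, _, _, φ, hφ⟩ := exists_embedding h x₀
  have hn : ∀ x, ‖φ x‖ ^ 2 = 2 * dist x x₀ := fun x => by
    rw [← real_inner_self_eq_norm_sq, hφ, dist_self]; ring
  have hd : ∀ x y, ‖φ x - φ y‖ ^ 2 = 2 * dist x y := fun x y => by
    rw [norm_sub_sq_real, hn, hn, hφ]; ring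
  have hc : Continuous φ := by
    rw [continuous_iff_continuousAt]
    intro y
    rw [ContinuousAt, tendsto_iff_norm_sub_tendsto_zero]
    have e : (fun x => ‖φ x - φ y‖) = fun x => √(2 * dist x y) := by
      ext x; rw [← hd, Real.sqrt_sq (norm_nonneg _)]
    rw [e]
    have : Continuous fun x => √(2 * dist x y) := by fun_prop
    simpa using this.tendsto y
  have hi : ∀ (ρ : Measure X) [IsProbabilityMeasure ρ], FiniteFirstMoment ρ →
      Integrable (fun x => ‖φ x‖) ρ := fun ρ _ hρ => by
    refine (((hρ.integrable x₀).const_mul 2).add (integrable_const 1)).mono'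
      hc.norm.measurable.aestronglyMeasurable (ae_of_all _ fun x => ?_)
    simp only [Pi.add_apply]
    rw [norm_norm, ← hn]
    nlinarith [sq_nonneg (‖φ x‖ - 1), norm_nonneg (φ x)]
  have key : ∀ (ρ σ : Measure X) [IsProbabilityMeasure ρ] [IsProbabilityMeasure σ] (m m' : H),
      FiniteFirstMoment ρ → FiniteFirstMoment σ →
      (∀ v : H, Integrable (fun x => inner ℝ v (φ x)) ρ ∧
        ∫ x, inner ℝ v (φ x) ∂ρ = inner ℝ v m) →
      (∀ v : H, Integrable (fun x => inner ℝ v (φ x)) σ ∧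
        ∫ x, inner ℝ v (φ x) ∂σ = inner ℝ v m') →
      ∫ x, ∫ y, dist x y ∂σ ∂ρ = ∫ x, dist x x₀ ∂ρ + ∫ y, dist y x₀ ∂σ - inner ℝ m m' := by
    intro ρ σ _ _ m m' hρ hσ hm hm'
    have e : ∀ x, ∫ y, dist x y ∂σ = dist x x₀ + ∫ y, dist y x₀ ∂σ - inner ℝ m' (φ x) := by
      intro x
      have : ∀ y, dist x y = (dist x x₀ + dist y x₀) - inner ℝ (φ x) (φ y) := fun y => by
        rw [hφ]; ring
      have I1 : Integrable (fun y => dist x x₀ + dist y x₀) σ :=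
        (integrable_const _).add (hσ.integrable x₀)
      rw [integral_congr_ae (ae_of_all _ this), integral_sub I1 (hm' _).1,
        integral_add (integrable_const _) (hσ.integrable x₀), (hm' _).2, real_inner_comm]
      simp
    have I2 : Integrable (fun x => dist x x₀ + ∫ y, dist y x₀ ∂σ) ρ :=
      (hρ.integrable x₀).add (integrable_const _)
    rw [integral_congr_ae (ae_of_all _ e), integral_sub I2 (hm _).1,
        integral_add (hρ.integrable x₀) (integrable_const _), (hm _).2, real_inner_comm]
    simp
  obtain ⟨m, hm⟩ := pettis φ hc μ (hi μ hμ)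
  obtain ⟨m', hm'⟩ := pettis φ hc ν (hi ν hν)
  rw [energyDistance, key μ ν m m' hμ hν hm hm', key μ μ m m hμ hμ hm hm,
    key ν ν m' m' hν hν hm' hm']
  have := real_inner_self_nonneg (x := m - m')
  rw [real_inner_sub_sub_self] at this
  linarith

/-- Finitely supported measure. -/
noncomputable def finM {X : Type*} [MeasurableSpace X] {n : ℕ} (x : Fin n → X) (p : Fin n → ℝ) :
    Measure X := ∑ i, ENNReal.ofReal (p i) • Measure.dirac (x i)

lemma finM_integrable {X : Type*} [MeasurableSpace X] [MeasurableSingletonClass X] {n : ℕ}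
    (x : Fin n → X) (p : Fin n → ℝ) (f : X → ℝ) : Integrable f (finM x p) := by
  rw [finM, integrable_finsetSum_measure]
  intro i _
  exact (integrable_dirac (by simp)).smul_measure ENNReal.ofReal_ne_top

lemma finM_integral {X : Type*} [MeasurableSpace X] [MeasurableSingletonClass X] {n : ℕ}
    (x : Fin n → X) (p : Fin n → ℝ) (hp : ∀ i, 0 ≤ p i) (f : X → ℝ) :
    ∫ y, f y ∂(finM x p) = ∑ i, p i * f (x i) := by
  rw [finM, integral_finsetSum_measure]
  · refine Finset.sum_congr rfl fun i _ => ?_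
    rw [integral_smul_measure, integral_dirac, ENNReal.toReal_ofReal (hp i), smul_eq_mul]
  · intro i _
    exact (integrable_dirac (by simp)).smul_measure ENNReal.ofReal_ne_top

lemma finM_prob {X : Type*} [MeasurableSpace X] {n : ℕ}
    (x : Fin n → X) (p : Fin n → ℝ) (hp : ∀ i, 0 ≤ p i) (hs : ∑ i, p i = 1) :
    IsProbabilityMeasure (finM x p) := by
  constructor
  simp only [finM, Measure.coe_finsetSum, Finset.sum_apply, Measure.smul_apply, measure_univ,
    smul_eq_mul, mul_one]
  rw [← ENNReal.ofReal_sum_of_nonneg fun i _ => hp i, hs, ENNReal.ofReal_one]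

lemma negType_of_energy {X : Type*} [MetricSpace X] [MeasurableSpace X] [BorelSpace X]
    (h : ∀ μ ν : Measure X, IsProbabilityMeasure μ → IsProbabilityMeasure ν →
        FiniteFirstMoment μ → FiniteFirstMoment ν → 0 ≤ energyDistance μ ν) :
    HasNegativeType X := by
  intro n x a ha
  have hpn : ∀ i, a i = max (a i) 0 - max (-a i) 0 := fun i => by
    rcases le_total (a i) 0 with h | h <;> simp [h]
  set s := ∑ i, max (a i) 0 with hs
  have hs' : ∑ i, max (-a i) 0 = s := by
    have : ∑ i, a i = s - ∑ i, max (-a i) 0 := by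
      rw [hs, ← Finset.sum_sub_distrib]; exact Finset.sum_congr rfl fun i _ => hpn i
    linarith
  have hs0 : 0 ≤ s := Finset.sum_nonneg fun i _ => le_max_right _ _
  rcases hs0.eq_or_lt with h0 | hpos
  · have z1 := (Finset.sum_eq_zero_iff_of_nonneg (fun i _ => le_max_right (a i) 0)).1 (hs ▸ h0.symm)
    have z2 := (Finset.sum_eq_zero_iff_of_nonneg (fun i _ => le_max_right (-a i) 0)).1
      (hs'.trans h0.symm)
    have : ∀ i, a i = 0 := fun i => by
      rw [hpn i, z1 i (Finset.mem_univ _), z2 i (Finset.mem_univ _), sub_zero]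
    simp [this]
  · rcases Nat.eq_zero_or_pos n with rfl | hn
    · simp
    let p : Fin n → ℝ := fun i => max (a i) 0 / s
    let q : Fin n → ℝ := fun i => max (-a i) 0 / s
    have hp : ∀ i, 0 ≤ p i := fun i => div_nonneg (le_max_right _ _) hs0
    have hq : ∀ i, 0 ≤ q i := fun i => div_nonneg (le_max_right _ _) hs0
    have hE := h (finM x p) (finM x q)
      (finM_prob x p hp (by simp only [p]; rw [← Finset.sum_div, ← hs, div_self hpos.ne']))
      (finM_prob x q hq (by simp only [q]; rw [← Finset.sum_div, hs', div_self hpos.ne']))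
      ⟨x ⟨0, hn⟩, finM_integrable _ _ _⟩ ⟨x ⟨0, hn⟩, finM_integrable _ _ _⟩
    have hpq : ∀ i, a i = s * (p i - q i) := fun i => by
      simp only [p, q]; rw [← sub_div, ← hpn]; field_simp
    simp only [energyDistance, finM_integral _ _ hp, finM_integral _ _ hq] at hE
    have hsym : ∑ i, q i * ∑ j, p j * dist (x i) (x j) = ∑ i, p i * ∑ j, q j * dist (x i) (x j) := by
      simp only [Finset.mul_sum]
      rw [Finset.sum_comm]
      refine Finset.sum_congr rfl fun i _ => Finset.sum_congr rfl fun j _ => ?_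
      rw [dist_comm]; ring
    have e : ∑ i, ∑ j, a i * a j * dist (x i) (x j) = - s ^ 2 * (
        ∑ i, p i * ∑ j, q j * dist (x i) (x j) + ∑ i, q i * ∑ j, p j * dist (x i) (x j)
        - ∑ i, p i * ∑ j, p j * dist (x i) (x j) - ∑ i, q i * ∑ j, q j * dist (x i) (x j)) := by
      simp only [← Finset.sum_add_distrib, ← Finset.sum_sub_distrib, Finset.mul_sum]
      refine Finset.sum_congr rfl fun i _ => Finset.sum_congr rfl fun j _ => ?_
      rw [hpq i, hpq j]; ring
    rw [e, hsym, neg_mul, neg_nonpos]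
    refine mul_nonneg (sq_nonneg s) ?_
    linarith

theorem hasNegativeType_iff_energyDistance_nonneg (X : Type*) [MetricSpace X]
    [MeasurableSpace X] [BorelSpace X] :
    HasNegativeType X ↔
      ∀ μ ν : Measure X, IsProbabilityMeasure μ → IsProbabilityMeasure ν →
        FiniteFirstMoment μ → FiniteFirstMoment ν → 0 ≤ energyDistance μ ν :=
  ⟨fun h μ ν _ _ hμ hν => energy_nonneg h μ ν hμ hν, negType_of_energy⟩
end

section
/- For all Borel probability measures μ, ν on the Euclidean space ℝ^d (with the standard Euclidean distance) having finite first moments, the energy distance satisfies E(μ, ν) = 2∫∫ ‖x−y‖ dμ(x)dν(y) − ∫∫ ‖x−x'‖ dμ(x)dμ(x') − ∫∫ ‖y−y'‖ dν(y)dν(y') ≥ 0, and E(μ, ν) = 0 if and only if μ = ν. -/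
open MeasureTheory

open MeasureTheory ProbabilityTheory Set
open scoped RealInnerProductSpace ComplexConjugate

namespace EDaux

lemma isOpenPos_stdGaussian (d : ℕ) :
    (stdGaussian (EuclideanSpace ℝ (Fin d))).IsOpenPosMeasure := by
  have : (gaussianReal 0 1).IsOpenPosMeasure :=
    (gaussianReal_absolutelyContinuous' 0 (v := 1) one_ne_zero).isOpenPosMeasure
  unfold stdGaussian
  refine Continuous.isOpenPosMeasure_map (by fun_prop) ?_
  intro y
  refine ⟨fun i => (stdOrthonormalBasis ℝ (EuclideanSpace ℝ (Fin d))).repr y i, ?_⟩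
  exact (stdOrthonormalBasis ℝ (EuclideanSpace ℝ (Fin d))).sum_repr y

lemma continuous_cf {E : Type*} [NormedAddCommGroup E] [InnerProductSpace ℝ E]
    [MeasurableSpace E] [BorelSpace E] [SecondCountableTopology E]
    (μ : Measure E) [IsProbabilityMeasure μ] : Continuous (charFun μ) := by
  simp only [funext charFun_apply]
  refine continuous_of_dominated (bound := fun _ => 1) ?_ ?_ (integrable_const _) ?_
  · intro t
    exact Continuous.aestronglyMeasurable (by fun_prop)
  · intro t
    exact Filter.Eventually.of_forall fun x => by rw [Complex.norm_exp_ofReal_mul_I]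
  · exact Filter.Eventually.of_forall fun x => by fun_prop

lemma f_bound (u : ℝ) (hu : 0 < u) :
    (1 - Real.exp (-u ^ 2 / 2)) / u ^ 2 ≤ 2 * (1 + u ^ 2)⁻¹ := by
  have h1 := Real.add_one_le_exp (-u ^ 2 / 2)
  have h2 := Real.exp_pos (-u ^ 2 / 2)
  rw [← div_eq_mul_inv, div_le_div_iff₀ (by positivity) (by positivity)]
  nlinarith [sq_nonneg u]

lemma f_pos (u : ℝ) (hu : 0 < u) :
    0 < (1 - Real.exp (-u ^ 2 / 2)) / u ^ 2 := by
  have : Real.exp (-u ^ 2 / 2) < 1 := by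
    rw [Real.exp_lt_one_iff]
    nlinarith [sq_pos_of_pos hu]
  have : 0 < 1 - Real.exp (-u ^ 2 / 2) := by linarith
  positivity

lemma f_int : IntegrableOn (fun u : ℝ => (1 - Real.exp (-u ^ 2 / 2)) / u ^ 2) (Ioi 0) := by
  refine Integrable.mono' ((integrable_inv_one_add_sq.const_mul 2).integrableOn) ?_ ?_
  · exact Measurable.aestronglyMeasurable (by fun_prop)
  · refine (ae_restrict_iff' measurableSet_Ioi).2 (Filter.Eventually.of_forall fun u hu => ?_)
    rw [Real.norm_of_nonneg (f_pos u hu).le]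
    exact f_bound u hu

noncomputable def C : ℝ := ∫ u in Ioi (0 : ℝ), (1 - Real.exp (-u ^ 2 / 2)) / u ^ 2

lemma C_pos : 0 < C := by
  unfold C
  rw [setIntegral_pos_iff_support_of_nonneg_ae _ f_int]
  · have : (Function.support fun u : ℝ => (1 - Real.exp (-u ^ 2 / 2)) / u ^ 2) ∩ Ioi 0
        = Ioi 0 := by
      apply inter_eq_right.2
      intro u hu
      exact (f_pos u hu).ne'
    rw [this]; simp
  · exact (ae_restrict_iff' measurableSet_Ioi).2
      (Filter.Eventually.of_forall fun u hu => (f_pos u hu).le)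

lemma f_scale (r : ℝ) (hr : 0 ≤ r) :
    IntegrableOn (fun s : ℝ => (1 - Real.exp (-(s * r) ^ 2 / 2)) / s ^ 2) (Ioi 0) ∧
    ∫ s in Ioi (0 : ℝ), (1 - Real.exp (-(s * r) ^ 2 / 2)) / s ^ 2 = C * r := by
  rcases hr.eq_or_lt with rfl | hr
  · simp
  · have key : (fun s : ℝ => (1 - Real.exp (-(s * r) ^ 2 / 2)) / s ^ 2)
        = fun s => r ^ 2 * ((fun u : ℝ => (1 - Real.exp (-u ^ 2 / 2)) / u ^ 2) (r * s)) := by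
      funext s
      have : r ≠ 0 := hr.ne'
      rcases eq_or_ne s 0 with rfl | hs
      · simp
      · simp only [mul_comm r s]
        field_simp
    constructor
    · rw [key]
      apply Integrable.const_mul
      have := (integrableOn_Ioi_comp_mul_left_iff
        (fun u : ℝ => (1 - Real.exp (-u ^ 2 / 2)) / u ^ 2) 0 hr).2 (by simpa using f_int)
      exact this
    · rw [key, integral_const_mul, integral_comp_mul_left_Ioi
        (fun u : ℝ => (1 - Real.exp (-u ^ 2 / 2)) / u ^ 2) _ hr]
      simp only [mul_zero, smul_eq_mul]
      change r ^ 2 * (r⁻¹ * C) = _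
      field_simp

section
variable {d : ℕ}
local notation "E" => EuclideanSpace ℝ (Fin d)

lemma gauss_cos (z : E) :
    ∫ g, (1 - Real.cos ⟪z, g⟫) ∂(stdGaussian E) = 1 - Real.exp (-‖z‖ ^ 2 / 2) := by
  have h := congrArg Complex.re (charFun_stdGaussian z)
  rw [charFun_apply, ← RCLike.re_eq_complex_re, ← integral_re] at h
  · rw [integral_sub (integrable_const _)]
    · simp only [integral_const, probReal_univ, smul_eq_mul, mul_one]
      congr 1
      have e : (-(‖z‖ : ℂ) ^ 2 / 2) = ((-‖z‖ ^ 2 / 2 : ℝ) : ℂ) := by push_cast; rfl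
      rw [e] at h
      simp only [RCLike.re_eq_complex_re, Complex.exp_ofReal_mul_I_re, Complex.exp_ofReal_re] at h
      rw [← h]
      simp_rw [real_inner_comm]
    · refine Integrable.of_bound (C := 1) (Continuous.aestronglyMeasurable (by fun_prop)) ?_
      exact Filter.Eventually.of_forall fun x => Real.abs_cos_le_one _
  · refine Integrable.of_bound (C := 1) (Continuous.aestronglyMeasurable (by fun_prop)) ?_
    exact Filter.Eventually.of_forall fun x => by rw [Complex.norm_exp_ofReal_mul_I]

/-- kernel -/
noncomputable def k (z : E) (t : ℝ × E) : ℝ := (1 - Real.cos ⟪z, t.1 • t.2⟫) / t.1 ^ 2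

lemma k_nonneg (z : E) (t : ℝ × E) : 0 ≤ k z t := by
  unfold k
  have := Real.cos_le_one ⟪z, t.1 • t.2⟫
  have : 0 ≤ 1 - Real.cos ⟪z, t.1 • t.2⟫ := by linarith
  positivity

noncomputable def m (d : ℕ) : Measure (ℝ × EuclideanSpace ℝ (Fin d)) :=
  ((volume : Measure ℝ).restrict (Ioi 0)).prod (stdGaussian _)

instance : SigmaFinite (m d) := by unfold m; infer_instance

lemma k_meas_z (z : E) : Measurable (k z) := by
  unfold k; fun_prop

lemma k_meas2 : Measurable (fun q : (E × E) × (ℝ × E) => k (q.1.1 - q.1.2) q.2) := by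
  unfold k; fun_prop

lemma k_meas : Measurable (fun p : E × (ℝ × E) => k p.1 p.2) := by
  unfold k; fun_prop

lemma k_inner (z : E) (s : ℝ) :
    ∫ g, k z (s, g) ∂(stdGaussian E) = (1 - Real.exp (-(s * ‖z‖) ^ 2 / 2)) / s ^ 2 := by
  simp only [k, integral_div]
  have := gauss_cos (s • z)
  simp only [inner_smul_left, norm_smul, mul_pow, Real.norm_eq_abs, sq_abs] at this
  simp only [inner_smul_right, mul_pow]
  simpa using congrArg (· / s ^ 2) this

lemma k_int (z : E) : Integrable (k z) (m d) ∧ ∫ t, k z t ∂(m d) = C * ‖z‖ := by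
  have hm : Measurable (k z) := k_meas_z z
  have hI : Integrable (k z) (m d) := by
    unfold m
    rw [integrable_prod_iff hm.aestronglyMeasurable]
    constructor
    · refine Filter.Eventually.of_forall fun s => ?_
      refine Integrable.of_bound (C := 2 / s ^ 2)
        (hm.comp measurable_prodMk_left).aestronglyMeasurable ?_
      refine Filter.Eventually.of_forall fun g => ?_
      rw [Real.norm_of_nonneg (k_nonneg _ _)]
      unfold k
      gcongr
      linarith [Real.neg_one_le_cos ⟪z, s • g⟫]
    · simp only [Real.norm_of_nonneg (k_nonneg _ _), k_inner]
      exact (f_scale ‖z‖ (norm_nonneg _)).1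
  refine ⟨hI, ?_⟩
  unfold m at hI ⊢
  rw [integral_prod _ hI]
  simp only [k_inner]
  exact (f_scale ‖z‖ (norm_nonneg _)).2

lemma dist_int (α β : Measure E) [IsProbabilityMeasure α] [IsProbabilityMeasure β]
    (hα : FiniteFirstMoment α) (hβ : FiniteFirstMoment β) :
    Integrable (fun p : E × E => dist p.1 p.2) (α.prod β) := by
  obtain ⟨a, ha⟩ := hα
  obtain ⟨b, hb⟩ := hβ
  refine Integrable.mono' (((ha.comp_fst β).add (integrable_const (dist a b))).add
    (hb.comp_snd α)) (Continuous.aestronglyMeasurable (by fun_prop)) ?_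
  refine Filter.Eventually.of_forall fun p => ?_
  rw [Real.norm_of_nonneg dist_nonneg]
  have := dist_triangle4 p.1 a b p.2
  rw [dist_comm b p.2] at this
  exact this

lemma cos_prod (α β : Measure E) [IsProbabilityMeasure α] [IsProbabilityMeasure β] (t : E) :
    ∫ p : E × E, (1 - Real.cos ⟪p.1 - p.2, t⟫) ∂(α.prod β)
      = 1 - (charFun α t * conj (charFun β t)).re := by
  have h : charFun α t * conj (charFun β t)
      = ∫ p : E × E, Complex.exp ((⟪p.1 - p.2, t⟫ : ℝ) * Complex.I) ∂(α.prod β) := by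
    rw [← charFun_neg, charFun_apply, charFun_apply, ← integral_prod_mul]
    congr 1
    funext p
    rw [← Complex.exp_add]
    congr 1
    simp only [inner_sub_left, inner_neg_right]
    push_cast
    ring
  rw [h, ← RCLike.re_eq_complex_re, ← integral_re, integral_sub (integrable_const _)]
  · simp [Complex.exp_ofReal_mul_I_re]
  · refine Integrable.of_bound (C := 1) (Continuous.aestronglyMeasurable (by fun_prop)) ?_
    exact Filter.Eventually.of_forall fun x => Real.abs_cos_le_one _
  · refine Integrable.of_bound (C := 1) (Continuous.aestronglyMeasurable (by fun_prop)) ?_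
    exact Filter.Eventually.of_forall fun x => by rw [Complex.norm_exp_ofReal_mul_I]

set_option maxHeartbeats 400000 in
lemma dist_formula (α β : Measure E) [IsProbabilityMeasure α] [IsProbabilityMeasure β]
    (hα : FiniteFirstMoment α) (hβ : FiniteFirstMoment β) :
    Integrable (fun t : ℝ × E =>
      (1 - (charFun α (t.1 • t.2) * conj (charFun β (t.1 • t.2))).re) / t.1 ^ 2) (m d) ∧
    ∫ t : ℝ × E, (1 - (charFun α (t.1 • t.2) * conj (charFun β (t.1 • t.2))).re) / t.1 ^ 2 ∂(m d)
      = C * ∫ x, ∫ y, dist x y ∂β ∂α := by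
  have hd := dist_int α β hα hβ
  have hm : Measurable (fun q : (E × E) × (ℝ × E) => k (q.1.1 - q.1.2) q.2) :=
    k_meas2
  have hI : Integrable (fun q : (E × E) × (ℝ × E) => k (q.1.1 - q.1.2) q.2)
      ((α.prod β).prod (m d)) := by
    rw [integrable_prod_iff hm.aestronglyMeasurable]
    constructor
    · exact Filter.Eventually.of_forall fun p => (k_int (p.1 - p.2)).1
    · have e : (fun p : E × E => ∫ t, ‖k (p.1 - p.2) t‖ ∂(m d)) = fun p => C * dist p.1 p.2 := by
        funext p
        rw [dist_eq_norm, ← (k_int (p.1 - p.2)).2]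
        congr 1
        funext t
        exact Real.norm_of_nonneg (k_nonneg _ _)
      exact e ▸ hd.const_mul C
  have hk : ∀ t : ℝ × E, ∫ p : E × E, k (p.1 - p.2) t ∂(α.prod β) =
      (1 - (charFun α (t.1 • t.2) * conj (charFun β (t.1 • t.2))).re) / t.1 ^ 2 := by
    intro t
    rw [← cos_prod, ← integral_div]
    simp only [k]
  simp only [← hk]
  refine ⟨hI.integral_prod_right, ?_⟩
  have := integral_integral_swap (f := fun (p : E × E) (t : ℝ × E) => k (p.1 - p.2) t) hI
  rw [← this]
  have e : (fun p : E × E => ∫ t, k (p.1 - p.2) t ∂(m d)) = fun p => C * dist p.1 p.2 := by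
    funext p
    rw [dist_eq_norm, ← (k_int (p.1 - p.2)).2]
  rw [e, integral_const_mul, integral_prod _ hd]

lemma energy_formula (μ ν : Measure E) [IsProbabilityMeasure μ] [IsProbabilityMeasure ν]
    (hμ : FiniteFirstMoment μ) (hν : FiniteFirstMoment ν) :
    Integrable (fun t : ℝ × E =>
      ‖charFun μ (t.1 • t.2) - charFun ν (t.1 • t.2)‖ ^ 2 / t.1 ^ 2) (m d) ∧
    ∫ t : ℝ × E, ‖charFun μ (t.1 • t.2) - charFun ν (t.1 • t.2)‖ ^ 2 / t.1 ^ 2 ∂(m d)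
      = C * energyDistance μ ν := by
  obtain ⟨i1, e1⟩ := dist_formula μ ν hμ hν
  obtain ⟨i2, e2⟩ := dist_formula μ μ hμ hμ
  obtain ⟨i3, e3⟩ := dist_formula ν ν hν hν
  have key : (fun t : ℝ × E =>
      ‖charFun μ (t.1 • t.2) - charFun ν (t.1 • t.2)‖ ^ 2 / t.1 ^ 2) = fun t : ℝ × E =>
      2 * ((1 - (charFun μ (t.1 • t.2) * conj (charFun ν (t.1 • t.2))).re) / t.1 ^ 2)
      - (1 - (charFun μ (t.1 • t.2) * conj (charFun μ (t.1 • t.2))).re) / t.1 ^ 2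
      - (1 - (charFun ν (t.1 • t.2) * conj (charFun ν (t.1 • t.2))).re) / t.1 ^ 2 := by
    funext t
    rw [← Complex.normSq_eq_norm_sq, Complex.normSq_apply]
    simp only [Complex.mul_re, Complex.conj_re, Complex.conj_im, Complex.sub_re, Complex.sub_im]
    ring
  rw [key]
  refine ⟨((i1.const_mul 2).sub i2).sub i3, ?_⟩
  have i12 := (i1.const_mul 2).sub i2
  simp only [Pi.sub_def] at i12
  rw [integral_sub i12 i3, integral_sub (i1.const_mul 2) i2,
    integral_const_mul, e1, e2, e3, energyDistance]
  ring

end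

end EDaux

open EDaux in
/-- On Euclidean space `ℝ^d`, the energy distance between Borel probability measures with
finite first moments is nonnegative and vanishes exactly when the measures coincide. -/
theorem energyDistance_euclidean (d : ℕ)
    (μ ν : Measure (EuclideanSpace ℝ (Fin d)))
    [IsProbabilityMeasure μ] [IsProbabilityMeasure ν]
    (hμ : FiniteFirstMoment μ) (hν : FiniteFirstMoment ν) :
    0 ≤ energyDistance μ ν ∧ (energyDistance μ ν = 0 ↔ μ = ν) := by
  obtain ⟨hI, he⟩ := energy_formula μ ν hμ hν
  have hnn : ∀ t : ℝ × EuclideanSpace ℝ (Fin d),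
      0 ≤ ‖charFun μ (t.1 • t.2) - charFun ν (t.1 • t.2)‖ ^ 2 / t.1 ^ 2 :=
    fun t => by positivity
  refine ⟨?_, ?_, ?_⟩
  · have : 0 ≤ C * energyDistance μ ν := he ▸ integral_nonneg hnn
    exact nonneg_of_mul_nonneg_right this C_pos
  · intro h0
    rw [h0, mul_zero, integral_eq_zero_iff_of_nonneg hnn hI] at he
    have h1 := Measure.ae_ae_of_ae_prod he
    have h2 := (ae_restrict_iff' measurableSet_Ioi).1 h1
    have h3 : ∃ s : ℝ, 0 < s ∧ ∀ᵐ g ∂(stdGaussian (EuclideanSpace ℝ (Fin d))),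
        ‖charFun μ (s • g) - charFun ν (s • g)‖ ^ 2 / s ^ 2 = 0 := by
      have : (ae ((volume : Measure ℝ).restrict (Ioi 0))).NeBot := by
        rw [ae_neBot]
        simp [Measure.restrict_eq_zero]
      obtain ⟨s, hs, hs'⟩ := (h1.and (ae_restrict_mem measurableSet_Ioi)).exists
      exact ⟨s, hs', hs⟩
    obtain ⟨s, hs, h4⟩ := h3
    have := isOpenPos_stdGaussian d
    have h5 : (fun g => charFun μ (s • g)) = fun g => charFun ν (s • g) := by
      have cμ := continuous_cf μ
      have cν := continuous_cf ν
      refine (Continuous.ae_eq_iff_eq (stdGaussian (EuclideanSpace ℝ (Fin d)))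
        (by fun_prop) (by fun_prop)).1 ?_
      filter_upwards [h4] with g hg
      have : s ≠ 0 := hs.ne'
      simpa [this, sub_eq_zero] using hg
    apply Measure.ext_of_charFun
    funext x
    have := congrFun h5 (s⁻¹ • x)
    simpa [smul_smul, hs.ne'] using this
  · rintro rfl
    simp only [energyDistance]
    ring
end

section
/- Let H be the space L²(ℕ × ℝ) of square-integrable real-valued functions with respect to the product of the counting measure on ℕ and the Lebesgue measure on ℝ (the space of persistence landscapes with p = 2). Then for all Borel probability measures μ, ν on H with finite first moments, the energy distance satisfies E(μ, ν) = 2∫∫ ‖x−y‖ dμ(x)dν(y) − ∫∫ ‖x−x'‖ dμ(x)dμ(x') − ∫∫ ‖y−y'‖ dν(y)dν(y') ≥ 0, and E(μ, ν) = 0 if and only if μ = ν. -/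
open MeasureTheory

/-- The product of the counting measure on `ℕ` and the Lebesgue measure on `ℝ`. -/
noncomputable abbrev landscapeMeasure : Measure (ℕ × ℝ) :=
  (Measure.count : Measure ℕ).prod (volume : Measure ℝ)

/-- The space `L²(ℕ × ℝ)` of persistence landscapes (`p = 2`). -/
noncomputable abbrev PLSpace : Type :=
  Lp (α := ℕ × ℝ) ℝ 2 landscapeMeasure

noncomputable instance : MeasurableSpace PLSpace := borel PLSpace
instance : BorelSpace PLSpace := ⟨rfl⟩

open Set Filter Topology

section EnergyAux

/-- A positive semidefinite real kernel has a Hilbert space feature map. -/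
lemma exists_feature {X : Type} (k : X → X → ℝ) (hsymm : ∀ x y, k x y = k y x)
    (hpos : ∀ c : X →₀ ℝ, 0 ≤ c.sum fun x a => c.sum fun y b => k y x * a * b) :
    ∃ (F : Type) (_ : NormedAddCommGroup F) (_ : InnerProductSpace ℝ F) (_ : CompleteSpace F)
      (φ : X → F), ∀ x y, inner ℝ (φ x) (φ y) = k x y := by
  let K : Matrix X X (ℝ →L[ℝ] ℝ) := Matrix.of fun x y => k x y • ContinuousLinearMap.id ℝ ℝ
  have hK : K.PosSemidef := by
    have ht := (RKHS.posSemidef_tfae (K := K)).out 0 2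
    refine ht.mpr ⟨?_, ?_⟩
    · ext x y
      have hid : ContinuousLinearMap.adjoint (ContinuousLinearMap.id ℝ ℝ)
          = ContinuousLinearMap.id ℝ ℝ := by
        rw [← ContinuousLinearMap.star_eq_adjoint]
        exact star_one (ℝ →L[ℝ] ℝ)
      simp [K, hsymm x y, ContinuousLinearMap.star_eq_adjoint, hid]
    · intro vv
      have := hpos vv
      simpa [K, mul_comm, mul_left_comm] using this
  have : Fact K.PosSemidef := ⟨hK⟩
  refine ⟨RKHS.OfKernel K, inferInstance, inferInstance, inferInstance,
    fun x => RKHS.kerFun (RKHS.OfKernel K) x (1 : ℝ), fun x y => ?_⟩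
  rw [← RKHS.kernel_inner, RKHS.OfKernel.kernel_ofKernel]
  simp [K, hsymm x y]

/-- The Gaussian kernel is positive semidefinite. -/
lemma gaussian_psd {H : Type*} [NormedAddCommGroup H] [InnerProductSpace ℝ H] (c : H →₀ ℝ) :
    0 ≤ c.sum fun x a => c.sum fun y b => Real.exp (-‖y - x‖ ^ 2 / 2) * a * b := by
  classical
  let E : Submodule ℝ H := Submodule.span ℝ (c.support : Set H)
  have : FiniteDimensional ℝ E := FiniteDimensional.span_finset ℝ c.support
  let : MeasurableSpace E := borel E
  have : BorelSpace E := ⟨rfl⟩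
  have hmem : ∀ x ∈ c.support, x ∈ E := fun x hx => Submodule.subset_span hx
  let P : H → E := fun x => if h : x ∈ E then ⟨x, h⟩ else 0
  have hP : ∀ x ∈ c.support, ∀ y ∈ c.support, ‖P y - P x‖ = ‖y - x‖ := by
    intro x hx y hy
    simp only [P, hmem x hx, hmem y hy, dif_pos]
    rfl
  let γ : Measure E := ProbabilityTheory.stdGaussian E
  let e : H → E → ℂ := fun x w => Complex.exp ((inner ℝ w (P x) : ℝ) * Complex.I)
  have hint : ∀ x y, Integrable (fun w => e y w * (starRingEnd ℂ) (e x w)) γ := by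
    intro x y
    refine Integrable.of_bound (C := 1) ?_ ?_
    · apply Continuous.aestronglyMeasurable
      simp only [e]
      fun_prop
    · refine ae_of_all _ fun w => ?_
      simp [e, Complex.norm_exp]
  have hval : ∀ x ∈ c.support, ∀ y ∈ c.support,
      ∫ w, e y w * (starRingEnd ℂ) (e x w) ∂γ = (Real.exp (-‖y - x‖ ^ 2 / 2) : ℂ) := by
    intro x hx y hy
    have := ProbabilityTheory.charFun_stdGaussian (E := E) (P y - P x)
    rw [hP x hx y hy, charFun_apply] at this
    push_cast
    rw [← this]
    refine integral_congr_ae (ae_of_all _ fun w => ?_)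
    simp only [e, ← Complex.exp_conj, ← Complex.exp_add, inner_sub_right]
    congr 1
    simp
    ring
  have key : ((c.sum fun x a => c.sum fun y b => Real.exp (-‖y - x‖ ^ 2 / 2) * a * b : ℝ) : ℂ)
      = ∫ w, ((‖∑ x ∈ c.support, (c x : ℂ) * e x w‖ ^ 2 : ℝ) : ℂ) ∂γ := by
    have h1 : ∀ w, ((‖∑ x ∈ c.support, (c x : ℂ) * e x w‖ ^ 2 : ℝ) : ℂ)
        = ∑ x ∈ c.support, ∑ y ∈ c.support,
          ((c x : ℂ) * (c y : ℂ)) * (e y w * (starRingEnd ℂ) (e x w)) := by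
      intro w
      push_cast
      rw [← Complex.mul_conj', map_sum, Finset.sum_mul_sum, Finset.sum_comm]
      refine Finset.sum_congr rfl fun x _ => Finset.sum_congr rfl fun y _ => ?_
      simp only [map_mul, Complex.conj_ofReal]
      ring
    simp_rw [h1]
    rw [integral_finsetSum _ (fun x _ => integrable_finsetSum _ fun y _ => (hint x y).const_mul _)]
    simp only [Finsupp.sum, Complex.ofReal_sum]
    refine Finset.sum_congr rfl fun x hx => ?_
    rw [integral_finsetSum _ (fun y _ => (hint x y).const_mul _)]
    refine Finset.sum_congr rfl fun y hy => ?_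
    rw [integral_const_mul, hval x hx y hy]
    push_cast
    ring
  rw [integral_complex_ofReal] at key
  rw [Complex.ofReal_injective key]
  exact integral_nonneg fun w => by positivity

/-- Gaussian kernel of width `t`. -/
noncomputable def gk {H : Type*} [NormedAddCommGroup H] (t : ℝ) (x y : H) : ℝ :=
  Real.exp (-(‖x - y‖ / t) ^ 2 / 2)

lemma gk_nonneg {H : Type*} [NormedAddCommGroup H] (t : ℝ) (x y : H) : 0 ≤ gk t x y :=
  (Real.exp_pos _).le

lemma gk_le_one {H : Type*} [NormedAddCommGroup H] (t : ℝ) (x y : H) : gk t x y ≤ 1 := by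
  unfold gk
  rw [Real.exp_le_one_iff]
  have := sq_nonneg (‖x - y‖ / t)
  linarith

lemma gk_norm_le {H : Type*} [NormedAddCommGroup H] (t : ℝ) (x y : H) : ‖gk t x y‖ ≤ 1 := by
  rw [Real.norm_of_nonneg (gk_nonneg t x y)]
  exact gk_le_one t x y

variable {H : Type} [NormedAddCommGroup H] [InnerProductSpace ℝ H] [CompleteSpace H]
  [SecondCountableTopology H] [MeasurableSpace H] [BorelSpace H]

lemma mmd (μ ν : Measure H) [IsProbabilityMeasure μ] [IsProbabilityMeasure ν] (t : ℝ) :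
    0 ≤ (∫ x, ∫ y, gk t x y ∂μ ∂μ) + (∫ x, ∫ y, gk t x y ∂ν ∂ν) - 2 * ∫ x, ∫ y, gk t x y ∂ν ∂μ ∧
    ((∫ x, ∫ y, gk t x y ∂μ ∂μ) + (∫ x, ∫ y, gk t x y ∂ν ∂ν)
        - 2 * (∫ x, ∫ y, gk t x y ∂ν ∂μ) = 0 →
      ∀ z, ∫ x, gk t z x ∂μ = ∫ x, gk t z x ∂ν) := by
  obtain ⟨F, _, _, _, φ, hφ⟩ := exists_feature (X := H)
    (fun x y => Real.exp (-‖x - y‖ ^ 2 / 2)) (fun x y => by rw [norm_sub_rev]) gaussian_psd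
  have hcont : Continuous φ := by
    rw [continuous_iff_continuousAt]
    intro x
    rw [ContinuousAt, tendsto_iff_norm_sub_tendsto_zero]
    have h1 : ∀ y, ‖φ y - φ x‖ = √(2 - 2 * Real.exp (-‖y - x‖ ^ 2 / 2)) := by
      intro y
      have h2 := norm_sub_sq_real (φ y) (φ x)
      rw [← real_inner_self_eq_norm_sq (φ y), ← real_inner_self_eq_norm_sq (φ x), hφ, hφ, hφ] at h2
      rw [← Real.sqrt_sq (norm_nonneg (φ y - φ x)), h2]
      congr 1
      simp
      ring
    simp_rw [h1]
    have h3 : Continuous fun y => √(2 - 2 * Real.exp (-‖y - x‖ ^ 2 / 2)) := by fun_prop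
    have := h3.tendsto x
    simpa using this
  have hnorm : ∀ x, ‖φ x‖ ≤ 1 := by
    intro x
    have : ‖φ x‖ ^ 2 = 1 := by
      rw [← real_inner_self_eq_norm_sq, hφ]
      simp
    nlinarith [norm_nonneg (φ x)]
  let ψ : H → F := fun x => φ (t⁻¹ • x)
  have hψ : ∀ x y, gk t x y = inner ℝ (ψ x) (ψ y) := by
    intro x y
    simp only [ψ, hφ, gk, ← smul_sub, norm_smul, div_eq_mul_inv, mul_pow]
    simp
    ring
  have hint : ∀ (ρ : Measure H) [IsProbabilityMeasure ρ], Integrable ψ ρ := by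
    intro ρ _
    refine Integrable.of_bound (C := 1) ?_ (ae_of_all _ fun x => hnorm _)
    apply Continuous.aestronglyMeasurable
    exact hcont.comp (by fun_prop)
  have h1 : ∀ (ρ : Measure H) [IsProbabilityMeasure ρ] (z : H),
      ∫ x, gk t z x ∂ρ = inner ℝ (ψ z) (∫ x, ψ x ∂ρ) := by
    intro ρ _ z
    simp_rw [hψ]
    exact integral_inner (hint ρ) _
  have h2 : ∀ (ρ σ : Measure H) [IsProbabilityMeasure ρ] [IsProbabilityMeasure σ],
      ∫ x, ∫ y, gk t x y ∂σ ∂ρ = inner ℝ (∫ x, ψ x ∂σ) (∫ x, ψ x ∂ρ) := by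
    intro ρ σ _ _
    simp_rw [h1 σ]
    rw [← integral_inner (hint ρ)]
    simp_rw [real_inner_comm]
  have h3 : (∫ x, ∫ y, gk t x y ∂μ ∂μ) + (∫ x, ∫ y, gk t x y ∂ν ∂ν)
        - 2 * (∫ x, ∫ y, gk t x y ∂ν ∂μ) = ‖(∫ x, ψ x ∂ν) - ∫ x, ψ x ∂μ‖ ^ 2 := by
    rw [h2, h2, h2, norm_sub_sq_real, real_inner_self_eq_norm_sq, real_inner_self_eq_norm_sq]
    ring
  rw [h3]
  refine ⟨by positivity, fun h z => ?_⟩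
  rw [h1, h1]
  have : (∫ x, ψ x ∂ν) - ∫ x, ψ x ∂μ = 0 := by simpa using h
  rw [sub_eq_zero.mp this]

/-- Scalar profile. -/
noncomputable def hfun (t : ℝ) : ℝ := 1 - Real.exp (-(1 / t) ^ 2 / 2)

lemma hfun_nonneg (t : ℝ) : 0 ≤ hfun t := by
  unfold hfun
  have : Real.exp (-(1 / t) ^ 2 / 2) ≤ 1 := by
    rw [Real.exp_le_one_iff]
    have := sq_nonneg (1 / t)
    linarith
  linarith

lemma hfun_meas : Measurable hfun := by unfold hfun; fun_prop

lemma hfun_int : IntegrableOn hfun (Ioi 0) := by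
  rw [← Ioc_union_Ioi_eq_Ioi (zero_le_one (α := ℝ))]
  refine IntegrableOn.union ?_ ?_
  · refine Measure.integrableOn_of_bounded (M := 1) (by simp) hfun_meas.aestronglyMeasurable ?_
    refine ae_of_all _ fun t => ?_
    rw [Real.norm_of_nonneg (hfun_nonneg t)]
    unfold hfun
    linarith [Real.exp_pos (-(1 / t) ^ 2 / 2)]
  · have h := integrableOn_Ioi_rpow_of_lt (a := -2) (by norm_num) (c := 1) one_pos
    refine Integrable.mono' h hfun_meas.aestronglyMeasurable ?_
    refine (ae_restrict_iff' measurableSet_Ioi).mpr (ae_of_all _ fun t ht => ?_)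
    have ht' : (0 : ℝ) < t := lt_trans one_pos ht
    rw [Real.norm_of_nonneg (hfun_nonneg t)]
    have h1 : t ^ (-2 : ℝ) = (1 / t) ^ 2 := by
      rw [Real.rpow_neg ht'.le]
      simp
    rw [h1, hfun]
    have := Real.add_one_le_exp (-(1 / t) ^ 2 / 2)
    have := sq_nonneg (1 / t)
    linarith

noncomputable def hC : ℝ := ∫ t in Ioi 0, hfun t

lemma hC_pos : 0 < hC := by
  unfold hC
  rw [setIntegral_pos_iff_support_of_nonneg_ae (ae_of_all _ hfun_nonneg) hfun_int]
  have : Function.support hfun ∩ Ioi 0 = Ioi 0 := by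
    refine inter_eq_right.mpr fun t ht => ?_
    have ht' : (0 : ℝ) < t := ht
    have : Real.exp (-(1 / t) ^ 2 / 2) < 1 := by
      rw [Real.exp_lt_one_iff]
      have : 0 < (1 / t) ^ 2 := by positivity
      linarith
    simp only [Function.mem_support, hfun]
    linarith
  rw [this]
  simp

lemma scaled (r : ℝ) (hr : 0 ≤ r) :
    IntegrableOn (fun t => 1 - Real.exp (-(r / t) ^ 2 / 2)) (Ioi 0) ∧
    ∫ t in Ioi 0, (1 - Real.exp (-(r / t) ^ 2 / 2)) = r * hC := by
  rcases hr.eq_or_lt with rfl | hr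
  · simp
  have h : (fun t => 1 - Real.exp (-(r / t) ^ 2 / 2)) = fun t => hfun (r⁻¹ * t) := by
    funext t
    simp [hfun, div_eq_mul_inv, mul_comm]
  rw [h]
  constructor
  · rw [integrableOn_Ioi_comp_mul_left_iff _ _ (inv_pos.mpr hr)]
    simpa using hfun_int
  · rw [integral_comp_mul_left_Ioi _ _ (inv_pos.mpr hr)]
    simp [hC]

lemma dist_integrable (μ ν : Measure H) [IsProbabilityMeasure μ] [IsProbabilityMeasure ν]
    (hμ : FiniteFirstMoment μ) (hν : FiniteFirstMoment ν) :
    Integrable (fun p : H × H => dist p.1 p.2) (μ.prod ν) := by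
  obtain ⟨a, ha⟩ := hμ
  obtain ⟨b, hb⟩ := hν
  have h1 : Integrable (fun p : H × H => dist p.1 a) (μ.prod ν) := ha.comp_fst ν
  have h2 : Integrable (fun p : H × H => dist p.2 b) (μ.prod ν) := hb.comp_snd μ
  refine Integrable.mono' ((h1.add h2).add (integrable_const (dist a b)))
    (by apply Continuous.aestronglyMeasurable; fun_prop) (ae_of_all _ fun p => ?_)
  rw [Real.norm_of_nonneg dist_nonneg]
  have := dist_triangle4 p.1 a b p.2
  rw [dist_comm b p.2] at this
  simp only [Pi.add_apply]
  linarith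

lemma gk_integrable (μ ν : Measure H) [IsProbabilityMeasure μ] [IsProbabilityMeasure ν] (t : ℝ) :
    Integrable (fun p : H × H => gk t p.1 p.2) (μ.prod ν) := by
  refine Integrable.of_bound (C := 1) ?_ (ae_of_all _ fun p => gk_norm_le _ _ _)
  apply Continuous.aestronglyMeasurable
  unfold gk
  fun_prop

lemma rep (μ ν : Measure H) [IsProbabilityMeasure μ] [IsProbabilityMeasure ν]
    (hμ : FiniteFirstMoment μ) (hν : FiniteFirstMoment ν) :
    IntegrableOn (fun t => 1 - ∫ x, ∫ y, gk t x y ∂ν ∂μ) (Ioi 0) ∧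
    ∫ t in Ioi 0, (1 - ∫ x, ∫ y, gk t x y ∂ν ∂μ) = (∫ x, ∫ y, dist x y ∂ν ∂μ) * hC := by
  have hd := dist_integrable μ ν hμ hν
  have hF : Integrable (fun q : (H × H) × ℝ => 1 - gk q.2 q.1.1 q.1.2)
      ((μ.prod ν).prod (volume.restrict (Ioi 0))) := by
    rw [integrable_prod_iff]
    · refine ⟨ae_of_all _ fun p => ?_, ?_⟩
      · have h0 := (scaled ‖p.1 - p.2‖ (norm_nonneg _)).1
        unfold gk
        exact h0
      have : (fun p : H × H => ∫ t in Ioi 0, ‖1 - gk t p.1 p.2‖) =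
          fun p => dist p.1 p.2 * hC := by
        funext p
        rw [dist_eq_norm, ← (scaled ‖p.1 - p.2‖ (norm_nonneg _)).2]
        refine integral_congr_ae (ae_of_all _ fun t => ?_)
        exact Real.norm_of_nonneg (sub_nonneg.mpr (gk_le_one _ _ _))
      rw [this]
      exact hd.mul_const _
    · apply Measurable.aestronglyMeasurable
      unfold gk
      fun_prop
  have hin : ∀ t, ∫ p : H × H, (1 - gk t p.1 p.2) ∂(μ.prod ν)
      = 1 - ∫ x, ∫ y, gk t x y ∂ν ∂μ := by
    intro t
    rw [integral_sub (integrable_const _) (gk_integrable μ ν t), integral_prod _ (gk_integrable μ ν t)]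
    simp
  constructor
  · have := hF.integral_prod_right
    simp only [hin] at this
    exact this
  · simp_rw [← hin]
    rw [← integral_integral_swap (f := fun (p : H × H) (t : ℝ) => 1 - gk t p.1 p.2) hF]
    have : (fun p : H × H => ∫ t in Ioi 0, (1 - gk t p.1 p.2)) =
          fun p => dist p.1 p.2 * hC := by
      funext p
      rw [dist_eq_norm, ← (scaled ‖p.1 - p.2‖ (norm_nonneg _)).2]
      rfl
    rw [this, integral_mul_const, integral_prod _ hd]

lemma gk_contOn (μ ν : Measure H) [IsProbabilityMeasure μ] [IsProbabilityMeasure ν] :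
    ContinuousOn (fun t => ∫ x, ∫ y, gk t x y ∂ν ∂μ) (Ioi 0) := by
  have : (fun t => ∫ x, ∫ y, gk t x y ∂ν ∂μ) =
      fun t => ∫ p : H × H, gk t p.1 p.2 ∂(μ.prod ν) := by
    funext t
    rw [integral_prod _ (gk_integrable μ ν t)]
  rw [this]
  refine continuousOn_of_dominated (bound := fun _ => 1)
    (fun t _ => (gk_integrable μ ν t).aestronglyMeasurable)
    (fun t _ => ae_of_all _ fun p => gk_norm_le _ _ _) (integrable_const _)
    (ae_of_all _ fun p => ?_)
  unfold gk
  have : ContinuousOn (fun t : ℝ => ‖p.1 - p.2‖ / t) (Ioi 0) :=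
    continuousOn_const.div continuousOn_id fun t ht => ne_of_gt ht
  fun_prop

/-- Exponential-quadratic functions. -/
def gaussSet (H : Type) [NormedAddCommGroup H] [InnerProductSpace ℝ H] :
    Set (BoundedContinuousFunction H ℝ) :=
  {f | ∃ (a : ℝ) (w : H) (c : ℝ), 0 < a ∧
    ∀ x, f x = Real.exp (-a * ‖x‖ ^ 2 + inner ℝ x w + c)}

/-- The monoid generated by exponential-quadratic functions. -/
def gaussMonoid (H : Type) [NormedAddCommGroup H] [InnerProductSpace ℝ H] :
    Submonoid (BoundedContinuousFunction H ℝ) where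
  carrier := {f | f = 1 ∨ f ∈ gaussSet H}
  one_mem' := Or.inl rfl
  mul_mem' := by
    rintro f g (rfl | hf) (rfl | hg)
    · left; simp
    · right; simpa using hg
    · right; simpa using hf
    · right
      obtain ⟨a, w, c, ha, hf⟩ := hf
      obtain ⟨a', w', c', ha', hg⟩ := hg
      refine ⟨a + a', w + w', c + c', add_pos ha ha', fun x => ?_⟩
      rw [BoundedContinuousFunction.mul_apply, hf, hg, ← Real.exp_add, inner_add_right]
      congr 1
      ring

/-- The star subalgebra spanned by Gaussians and constants. -/
noncomputable def gaussAlg (H : Type) [NormedAddCommGroup H] [InnerProductSpace ℝ H] :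
    StarSubalgebra ℝ (BoundedContinuousFunction H ℝ) where
  toSubalgebra := Algebra.adjoin ℝ (gaussMonoid H : Set (BoundedContinuousFunction H ℝ))
  star_mem' := by
    intro f hf
    have : star f = f := by ext x; simp
    change star f ∈ _
    rw [this]
    exact hf

lemma char_gauss (μ ν : Measure H) [IsProbabilityMeasure μ] [IsProbabilityMeasure ν]
    (h : ∀ t : ℝ, 0 < t → ∀ z, ∫ x, gk t z x ∂μ = ∫ x, gk t z x ∂ν) : μ = ν := by
  refine ext_of_forall_mem_subalgebra_integral_eq_of_pseudoEMetric_complete_countable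
    (𝕜 := ℝ) (A := gaussAlg H) ?_ ?_
  · intro x y hxy
    let f : BoundedContinuousFunction H ℝ := BoundedContinuousFunction.ofNormedAddCommGroup
      (fun z => gk 1 z x) (by unfold gk; fun_prop) 1 (fun z => gk_norm_le _ _ _)
    have hf : f ∈ gaussAlg H := by
      refine Algebra.subset_adjoin (Or.inr ⟨1 / 2, x, -‖x‖ ^ 2 / 2, by norm_num, fun z => ?_⟩)
      change Real.exp _ = _
      rw [div_one, norm_sub_sq_real]
      congr 1
      ring
    refine ⟨f, ⟨_, ⟨f, hf, rfl⟩, rfl⟩, ?_⟩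
    change gk 1 x x ≠ gk 1 y x
    have : 0 < ‖y - x‖ := norm_pos_iff.mpr (sub_ne_zero.mpr (Ne.symm hxy))
    intro he
    simp only [gk, Real.exp_eq_exp, sub_self, norm_zero, div_one] at he
    nlinarith
  · intro g hg
    have hg' : g ∈ Subalgebra.toSubmodule
      (Algebra.adjoin ℝ (gaussMonoid H : Set (BoundedContinuousFunction H ℝ))) := hg
    rw [Algebra.adjoin_eq_span, Submonoid.closure_eq] at hg'
    clear hg
    induction hg' using Submodule.span_induction with
    | zero => simp
    | add f g _ _ hf hg =>
      have e1 := integral_add (f.integrable μ) (g.integrable μ)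
      have e2 := integral_add (f.integrable ν) (g.integrable ν)
      simp only [BoundedContinuousFunction.add_apply]
      rw [e1, e2, hf, hg]
    | smul a f _ hf =>
      simp only [BoundedContinuousFunction.coe_smul, integral_smul, hf]
    | mem f hf =>
      rcases hf with rfl | ⟨a, w, c, ha, hf⟩
      · simp
      · obtain ⟨t, rfl_t⟩ : ∃ t : ℝ, t = 1 / √(2 * a) := ⟨_, rfl⟩
        have ht : 0 < t := by rw [rfl_t]; positivity
        have ht2 : 1 / t ^ 2 = 2 * a := by
          simp only [rfl_t, div_pow, one_pow, one_div_one_div]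
          exact Real.sq_sqrt (by positivity)
        have hfx : ∀ x, f x = Real.exp (c + ‖t ^ 2 • w‖ ^ 2 * a) * gk t (t ^ 2 • w) x := by
          intro x
          rw [hf, gk, ← Real.exp_add, div_pow, div_eq_mul_one_div (‖t ^ 2 • w - x‖ ^ 2) (t ^ 2), ht2,
            norm_sub_sq_real, inner_smul_left, real_inner_comm]
          congr 1
          have : t ^ 2 * (2 * a) = 1 := by rw [← ht2]; field_simp
          simp only [conj_trivial]
          linear_combination (-inner ℝ w x) * this
        simp_rw [hfx, integral_const_mul, h t ht]

theorem energy_general (μ ν : Measure H) [IsProbabilityMeasure μ] [IsProbabilityMeasure ν]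
    (hμ : FiniteFirstMoment μ) (hν : FiniteFirstMoment ν) :
    0 ≤ energyDistance μ ν ∧ (energyDistance μ ν = 0 ↔ μ = ν) := by
  obtain ⟨i1, e1⟩ := rep μ ν hμ hν
  obtain ⟨i2, e2⟩ := rep μ μ hμ hμ
  obtain ⟨i3, e3⟩ := rep ν ν hν hν
  let D : ℝ → ℝ := fun t => (∫ x, ∫ y, gk t x y ∂μ ∂μ) + (∫ x, ∫ y, gk t x y ∂ν ∂ν)
        - 2 * (∫ x, ∫ y, gk t x y ∂ν ∂μ)
  have hDeq : D = fun t => 2 * (1 - ∫ x, ∫ y, gk t x y ∂ν ∂μ) - (1 - ∫ x, ∫ y, gk t x y ∂μ ∂μ)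
      - (1 - ∫ x, ∫ y, gk t x y ∂ν ∂ν) := by
    funext t
    simp only [D]
    ring
  have hDi : IntegrableOn D (Ioi 0) := by
    rw [hDeq]
    exact ((i1.const_mul 2).sub i2).sub i3
  have hE : ∫ t in Ioi 0, D t = energyDistance μ ν * hC := by
    have s1 := integral_sub (i1.const_mul 2) i2
    have s2 := integral_sub ((i1.const_mul 2).sub i2) i3
    simp only [Pi.sub_apply] at s2
    rw [hDeq, s2, s1, integral_const_mul, e1, e2, e3, energyDistance]
    ring
  have hD0 : ∀ t, 0 ≤ D t := fun t => (mmd μ ν t).1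
  refine ⟨?_, ?_, ?_⟩
  · have : 0 ≤ energyDistance μ ν * hC := by
      rw [← hE]
      exact integral_nonneg hD0
    exact nonneg_of_mul_nonneg_left this hC_pos
  · intro h0
    rw [h0, zero_mul, integral_eq_zero_iff_of_nonneg hD0 hDi] at hE
    have hcont : ContinuousOn D (Ioi 0) :=
      ((gk_contOn μ μ).add (gk_contOn ν ν)).sub (continuousOn_const.mul (gk_contOn μ ν))
    have hz := Measure.eqOn_open_of_ae_eq hE isOpen_Ioi hcont continuousOn_const
    exact char_gauss μ ν fun t ht => (mmd μ ν t).2 (hz ht)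
  · rintro rfl
    simp only [energyDistance]
    ring

end EnergyAux

/-- On the space of persistence landscapes `L²(ℕ × ℝ)`, the energy distance between Borel
probability measures with finite first moments is nonnegative and vanishes exactly when
the measures coincide. -/
theorem energyDistance_persistenceLandscapes
    (μ ν : Measure PLSpace)
    [IsProbabilityMeasure μ] [IsProbabilityMeasure ν]
    (hμ : FiniteFirstMoment μ) (hν : FiniteFirstMoment ν) :
    0 ≤ energyDistance μ ν ∧ (energyDistance μ ν = 0 ↔ μ = ν) := by
  have : Fact ((2 : ENNReal) ≠ ⊤) := ⟨by simp⟩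
  exact energy_general μ ν hμ hν
end

section
/- Let H be a real inner product space. For every n ≥ 1, all points x_1, …, x_n ∈ H and all real coefficients α_1, …, α_n with Σ_{i=1}^n α_i = 0, one has Σ_{i=1}^n Σ_{j=1}^n α_i α_j ‖x_i − x_j‖ ≤ 0; that is, H with the norm-induced distance has negative type. -/
open MeasureTheory Set in
lemma negType_psd {H : Type*} [NormedAddCommGroup H] [InnerProductSpace ℝ H]
    (n : ℕ) (x : Fin n → H) (t : ℝ) (ht : 0 < t) (m : ℕ) :
    (Matrix.of fun i j : Fin n => ((‖x i‖ ^ 2 * ‖x j‖ ^ 2 + 2 * t * inner ℝ (x i) (x j)) /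
      ((‖x i‖ ^ 2 + t) * (‖x j‖ ^ 2 + t))) ^ m).PosSemidef := by
  induction m with
  | zero =>
    have h := Matrix.posSemidef_vecMulVec_self_star (fun _ : Fin n => (1 : ℝ))
    refine (congrArg Matrix.PosSemidef ?_).mpr h
    ext i j
    simp [Matrix.vecMulVec]
  | succ m ih =>
    have h1 := Matrix.posSemidef_vecMulVec_self_star
      (fun i : Fin n => (‖x i‖ ^ 2 / (‖x i‖ ^ 2 + t) : ℝ))
    have h2 := Matrix.posSemidef_gram (𝕜 := ℝ) (fun i : Fin n => (‖x i‖ ^ 2 + t)⁻¹ • x i)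
    have h3 := h1.add (h2.smul (by positivity : (0 : ℝ) ≤ 2 * t))
    have h4 := ih.hadamard h3
    refine (congrArg Matrix.PosSemidef ?_).mpr h4
    ext i j
    have hi : ‖x i‖ ^ 2 + t ≠ 0 := by positivity
    have hj : ‖x j‖ ^ 2 + t ≠ 0 := by positivity
    simp only [Matrix.of_apply, Matrix.hadamard_apply, Matrix.add_apply, Matrix.smul_apply,
      Matrix.vecMulVec_apply, Matrix.gram_apply, real_inner_smul_left, real_inner_smul_right,
      pow_succ, smul_eq_mul, Pi.star_apply, star_trivial]
    congr 1
    field_simp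

lemma negType_quad {n : ℕ} {A : Matrix (Fin n) (Fin n) ℝ} (hA : A.PosSemidef) (b : Fin n → ℝ) :
    0 ≤ ∑ i, ∑ j, b i * b j * A i j := by
  have h := (Matrix.posSemidef_iff_dotProduct_mulVec.1 hA).2 b
  simp only [dotProduct, Matrix.mulVec, Finset.mul_sum, Pi.star_apply, star_trivial] at h
  refine h.trans_eq (Finset.sum_congr rfl fun i _ => Finset.sum_congr rfl fun j _ => ?_)
  ring

lemma negType_inv {H : Type*} [NormedAddCommGroup H] [InnerProductSpace ℝ H]
    (n : ℕ) (x : Fin n → H) (a : Fin n → ℝ) (t : ℝ) (ht : 0 < t) :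
    0 ≤ ∑ i, ∑ j, a i * a j * (t + ‖x i - x j‖ ^ 2)⁻¹ := by
  set K : Fin n → Fin n → ℝ := fun i j =>
    (‖x i‖ ^ 2 * ‖x j‖ ^ 2 + 2 * t * inner ℝ (x i) (x j)) /
      ((‖x i‖ ^ 2 + t) * (‖x j‖ ^ 2 + t)) with hK
  set b : Fin n → ℝ := fun i => a i / (‖x i‖ ^ 2 + t) with hb
  have hK1 : ∀ i j, |K i j| < 1 := by
    intro i j
    have hp : 0 < (‖x i‖ ^ 2 + t) * (‖x j‖ ^ 2 + t) := by positivity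
    have hc := abs_real_inner_le_norm (x i) (x j)
    rw [hK]
    simp only
    rw [abs_div, abs_of_pos hp, div_lt_one hp]
    calc _ ≤ ‖x i‖ ^ 2 * ‖x j‖ ^ 2 + 2 * t * |inner ℝ (x i) (x j)| := by
          refine (abs_add_le _ _).trans ?_
          rw [abs_of_nonneg (by positivity : 0 ≤ ‖x i‖ ^ 2 * ‖x j‖ ^ 2), abs_mul,
            abs_of_pos (by positivity : 0 < 2 * t)]
      _ ≤ ‖x i‖ ^ 2 * ‖x j‖ ^ 2 + 2 * t * (‖x i‖ * ‖x j‖) := by gcongr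
      _ < _ := by nlinarith [mul_nonneg ht.le (sq_nonneg (‖x i‖ - ‖x j‖)), mul_pos ht ht]
  have hs : HasSum (fun m : ℕ => ∑ i, ∑ j, b i * b j * t * K i j ^ m)
      (∑ i, ∑ j, b i * b j * t * (1 - K i j)⁻¹) :=
    hasSum_sum fun i _ => hasSum_sum fun j _ =>
      (hasSum_geometric_of_abs_lt_one (hK1 i j)).mul_left _
  have h0 : 0 ≤ ∑ i, ∑ j, b i * b j * t * (1 - K i j)⁻¹ := by
    refine hs.nonneg fun m => ?_
    have h := mul_nonneg ht.le (negType_quad (negType_psd n x t ht m) b)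
    simp only [Finset.mul_sum] at h
    refine h.trans_eq (Finset.sum_congr rfl fun i _ => Finset.sum_congr rfl fun j _ => ?_)
    simp only [Matrix.of_apply, hK]
    ring
  refine h0.trans_eq (Finset.sum_congr rfl fun i _ => Finset.sum_congr rfl fun j _ => ?_)
  have hi : ‖x i‖ ^ 2 + t ≠ 0 := by positivity
  have hj : ‖x j‖ ^ 2 + t ≠ 0 := by positivity
  have hD : t + ‖x i - x j‖ ^ 2 ≠ 0 := by positivity
  have hE : 1 - K i j =
      t * (t + ‖x i - x j‖ ^ 2) / ((‖x i‖ ^ 2 + t) * (‖x j‖ ^ 2 + t)) := by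
    rw [hK, @norm_sub_sq_real]
    field_simp
    ring
  rw [hE, hb]
  field_simp

open MeasureTheory Set in
/-- A real inner product space, with the distance induced by its norm, has negative type:
for all points `x_1, …, x_n` and real coefficients `α_1, …, α_n` summing to zero,
`∑_i ∑_j α_i α_j ‖x_i − x_j‖ ≤ 0`. -/
theorem innerProductSpace_negativeType {H : Type*} [NormedAddCommGroup H]
    [InnerProductSpace ℝ H] :
    ∀ (n : ℕ) (x : Fin n → H) (a : Fin n → ℝ), (∑ i, a i) = 0 →
      ∑ i, ∑ j, a i * a j * ‖x i - x j‖ ≤ 0 := by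
  intro n x a ha
  obtain ⟨μ, hμ⟩ := Real.exists_measure_rpow_eq_integral_rpowIntegrand₀₁
    (p := 1 / 2) ⟨by norm_num, by norm_num⟩
  have hn : ∀ i j, ‖x i - x j‖ =
      ∫ t in Ioi 0, Real.rpowIntegrand₀₁ (1 / 2) t (‖x i - x j‖ ^ 2) ∂μ := by
    intro i j
    rw [← (hμ (‖x i - x j‖ ^ 2) (mem_Ici.2 (sq_nonneg _))).2, ← Real.sqrt_eq_rpow,
      Real.sqrt_sq (norm_nonneg _)]
  have hI : ∀ i j, Integrable
      (fun t => a i * a j * Real.rpowIntegrand₀₁ (1 / 2) t (‖x i - x j‖ ^ 2))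
      (μ.restrict (Ioi 0)) := fun i j =>
    (hμ (‖x i - x j‖ ^ 2) (mem_Ici.2 (sq_nonneg _))).1.integrable.const_mul _
  have hS : ∑ i, ∑ j, a i * a j * ‖x i - x j‖ = ∫ t in Ioi 0, ∑ i, ∑ j,
      a i * a j * Real.rpowIntegrand₀₁ (1 / 2) t (‖x i - x j‖ ^ 2) ∂μ := by
    rw [integral_finsetSum _ fun i _ => integrable_finsetSum _ fun j _ => hI i j]
    refine Finset.sum_congr rfl fun i _ => ?_
    rw [integral_finsetSum _ fun j _ => hI i j]
    refine Finset.sum_congr rfl fun j _ => ?_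
    rw [integral_const_mul, ← hn]
  rw [hS]
  refine setIntegral_nonpos measurableSet_Ioi fun t ht => ?_
  have ht : 0 < t := ht
  have h := mul_nonneg (Real.rpow_nonneg ht.le (1 / 2)) (negType_inv n x a t ht)
  have hz : ∑ i, ∑ j, a i * a j * t⁻¹ = 0 := by
    simp only [← Finset.sum_mul, ← Finset.mul_sum, ha]
    simp
  have he : ∑ i, ∑ j, a i * a j * Real.rpowIntegrand₀₁ (1 / 2) t (‖x i - x j‖ ^ 2) =
      t ^ (1 / 2 : ℝ) * (∑ i, ∑ j, a i * a j * t⁻¹) -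
      t ^ (1 / 2 : ℝ) * (∑ i, ∑ j, a i * a j * (t + ‖x i - x j‖ ^ 2)⁻¹) := by
    simp only [Finset.mul_sum, ← Finset.sum_sub_distrib, Real.rpowIntegrand₀₁]
    refine Finset.sum_congr rfl fun i _ => Finset.sum_congr rfl fun j _ => ?_
    ring
  rw [he, hz]
  linarith
end

section
/- Let (X, δ) be a metric space, ρ > 0, and let Λ_1, …, Λ_k be finite samples (tuples) in X of sizes n_1, …, n_k, with pooled sample Λ of size n = n_1 + … + n_k obtained by concatenation. Define d_ρ(A, B) = (1/(|A||B|)) Σ_{a∈A} Σ_{b∈B} δ(a,b)^ρ for finite samples A, B, the total dispersion T_ρ = (n/2) d_ρ(Λ, Λ), the within-sample dispersion W_ρ = Σ_{i=1}^k (n_i/2) d_ρ(Λ_i, Λ_i), and the between-sample dispersion B_ρ = Σ_{1 ≤ i < j ≤ k} (n_i n_j/(2n)) ( 2 d_ρ(Λ_i, Λ_j) − d_ρ(Λ_i, Λ_i) − d_ρ(Λ_j, Λ_j) ). Then T_ρ = W_ρ + B_ρ. -/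
/-- The `d_ρ`-distance between two finite samples `A` and `B` in a metric space:
`d_ρ(A,B) = (1/(|A||B|)) ∑_{a∈A} ∑_{b∈B} δ(a,b)^ρ`. -/
noncomputable def dRho {X : Type*} [MetricSpace X] (ρ : ℝ) {α β : Type*}
    [Fintype α] [Fintype β] (A : α → X) (B : β → X) : ℝ :=
  (1 / ((Fintype.card α : ℝ) * (Fintype.card β : ℝ))) * ∑ a, ∑ b, dist (A a) (B b) ^ ρ

lemma sum_Ioi_symm {k : ℕ} (F : Fin k → Fin k → ℝ) (hs : ∀ i j, F i j = F j i)
    (hd : ∀ i, F i i = 0) :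
    ∑ i, ∑ j, F i j = 2 * ∑ i, ∑ j ∈ Finset.Ioi i, F i j := by
  have h1 : ∑ i, ∑ j ∈ Finset.Ioi i, F i j = ∑ i, ∑ j, if i < j then F i j else 0 := by
    refine Finset.sum_congr rfl fun i _ => ?_
    rw [← Finset.sum_filter]
    refine Finset.sum_congr ?_ fun _ _ => rfl
    ext j; simp
  have h2 : ∑ i, ∑ j, (if i < j then F i j else 0)
      = ∑ i, ∑ j, if j < i then F i j else 0 := by
    rw [Finset.sum_comm]
    refine Finset.sum_congr rfl fun i _ => Finset.sum_congr rfl fun j _ => ?_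
    rw [hs]
  rw [two_mul, h1]
  nth_rewrite 2 [h2]
  simp only [← Finset.sum_add_distrib]
  refine Finset.sum_congr rfl fun i _ => Finset.sum_congr rfl fun j _ => ?_
  rcases lt_trichotomy i j with h | h | h
  · simp [h, h.not_gt]
  · subst h; simp [hd]
  · simp [h, h.not_gt]

lemma dRho_symm {X : Type*} [MetricSpace X] (ρ : ℝ) {α β : Type*}
    [Fintype α] [Fintype β] (A : α → X) (B : β → X) : dRho ρ A B = dRho ρ B A := by
  unfold dRho
  rw [Finset.sum_comm, mul_comm (Fintype.card α : ℝ)]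
  simp only [dist_comm]

/-- DISCO decomposition: the total dispersion of the pooled sample equals the sum of the
within-sample dispersion and the between-sample dispersion, `T_ρ = W_ρ + B_ρ`. -/
theorem disco_decomposition {X : Type*} [MetricSpace X] (ρ : ℝ) (hρ : 0 < ρ)
    {k : ℕ} (n : Fin k → ℕ) (hn : ∀ i, 0 < n i)
    (Λ : (i : Fin k) → Fin (n i) → X) :
    ((∑ i, n i : ℕ) : ℝ) / 2
        * dRho ρ (fun p : Σ i, Fin (n i) => Λ p.1 p.2) (fun p : Σ i, Fin (n i) => Λ p.1 p.2)
      = (∑ i, (n i : ℝ) / 2 * dRho ρ (Λ i) (Λ i))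
        + ∑ i, ∑ j ∈ Finset.Ioi i,
            (n i : ℝ) * (n j : ℝ) / (2 * ((∑ i', n i' : ℕ) : ℝ))
              * (2 * dRho ρ (Λ i) (Λ j) - dRho ρ (Λ i) (Λ i) - dRho ρ (Λ j) (Λ j)) := by
  rcases Nat.eq_zero_or_pos k with hk | hk
  · subst hk
    simp
  have hN : ((∑ i, n i : ℕ) : ℝ) ≠ 0 := by
    have : 0 < ∑ i, n i := Finset.sum_pos (fun i _ => hn i) ⟨⟨0, hk⟩, Finset.mem_univ _⟩
    exact_mod_cast this.ne'
  have hB := sum_Ioi_symm (fun i j => (n i : ℝ) * (n j : ℝ) / (2 * ((∑ i', n i' : ℕ) : ℝ))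
              * (2 * dRho ρ (Λ i) (Λ j) - dRho ρ (Λ i) (Λ i) - dRho ρ (Λ j) (Λ j)))
    (fun i j => by simp only [dRho_symm ρ (Λ i) (Λ j)]; ring) (fun i => by ring)
  have hT : dRho ρ (fun p : Σ i, Fin (n i) => Λ p.1 p.2) (fun p : Σ i, Fin (n i) => Λ p.1 p.2)
      = 1 / (((∑ i, n i : ℕ) : ℝ) * ((∑ i, n i : ℕ) : ℝ))
        * ∑ i, ∑ j, (n i : ℝ) * (n j : ℝ) * dRho ρ (Λ i) (Λ j) := by
    have h (i j) : (n i : ℝ) * (n j : ℝ) * dRho ρ (Λ i) (Λ j)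
        = ∑ a, ∑ b, dist (Λ i a) (Λ j b) ^ ρ := by
      have h1 : (n i : ℝ) ≠ 0 := by exact_mod_cast (hn i).ne'
      have h2 : (n j : ℝ) ≠ 0 := by exact_mod_cast (hn j).ne'
      unfold dRho
      simp only [Fintype.card_fin]
      field_simp
    simp only [h]
    unfold dRho
    simp only [Fintype.card_sigma, Fintype.card_fin, Fintype.sum_sigma]
    congr 1
    refine Finset.sum_congr rfl fun i _ => ?_
    rw [Finset.sum_comm]
  have hS : ((∑ i, n i : ℕ) : ℝ) = ∑ i, (n i : ℝ) := by push_cast; rfl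
  have hF : ∑ i, ∑ j, ((n i : ℝ) * (n j : ℝ) / (2 * ((∑ i', n i' : ℕ) : ℝ))
              * (2 * dRho ρ (Λ i) (Λ j) - dRho ρ (Λ i) (Λ i) - dRho ρ (Λ j) (Λ j)))
      = 1 / ((∑ i, n i : ℕ) : ℝ) * ∑ i, ∑ j, (n i : ℝ) * (n j : ℝ) * dRho ρ (Λ i) (Λ j)
        - ∑ i, (n i : ℝ) * dRho ρ (Λ i) (Λ i) := by
    have e1 : ∑ i, ∑ j, (n i : ℝ) * dRho ρ (Λ i) (Λ i) * (n j : ℝ)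
        = ((∑ i, n i : ℕ) : ℝ) * ∑ i, (n i : ℝ) * dRho ρ (Λ i) (Λ i) := by
      rw [hS, mul_comm, Finset.sum_mul_sum]
    have e2 : ∑ i, ∑ j, (n i : ℝ) * ((n j : ℝ) * dRho ρ (Λ j) (Λ j))
        = ((∑ i, n i : ℕ) : ℝ) * ∑ i, (n i : ℝ) * dRho ρ (Λ i) (Λ i) := by
      rw [hS, Finset.sum_mul_sum]
    generalize ((∑ i, n i : ℕ) : ℝ) = N at *
    trans 1 / N * ∑ i, ∑ j, (n i : ℝ) * (n j : ℝ) * dRho ρ (Λ i) (Λ j)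
      - 1 / (2 * N) * ∑ i, ∑ j, (n i : ℝ) * dRho ρ (Λ i) (Λ i) * (n j : ℝ)
      - 1 / (2 * N) * ∑ i, ∑ j, (n i : ℝ) * ((n j : ℝ) * dRho ρ (Λ j) (Λ j))
    · simp only [Finset.mul_sum, ← Finset.sum_sub_distrib]
      refine Finset.sum_congr rfl fun i _ => Finset.sum_congr rfl fun j _ => ?_
      field_simp
    · rw [e1, e2]
      field_simp
      ring
  have hW : ∑ i, (n i : ℝ) / 2 * dRho ρ (Λ i) (Λ i)
      = 1 / 2 * ∑ i, (n i : ℝ) * dRho ρ (Λ i) (Λ i) := by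
    rw [Finset.mul_sum]
    exact Finset.sum_congr rfl fun i _ => by ring
  rw [hF] at hB
  rw [hT, hW]
  have e3 : ((∑ i, n i : ℕ) : ℝ) / 2 * (1 / (((∑ i, n i : ℕ) : ℝ) * ((∑ i, n i : ℕ) : ℝ))
        * ∑ i, ∑ j, (n i : ℝ) * (n j : ℝ) * dRho ρ (Λ i) (Λ j))
      = 1 / 2 * (1 / ((∑ i, n i : ℕ) : ℝ)
        * ∑ i, ∑ j, (n i : ℝ) * (n j : ℝ) * dRho ρ (Λ i) (Λ j)) := by
    field_simp
  rw [e3]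
  linarith
end

section
/- Let x_1, …, x_m and y_1, …, y_n be points in a real inner product space with means x̄ = (1/m) Σ_i x_i and ȳ = (1/n) Σ_j y_j. Then 2 d_2(A, B) − d_2(A, A) − d_2(B, B) = 2 ‖x̄ − ȳ‖², where A = (x_1,…,x_m), B = (y_1,…,y_n) and d_2(A,B) = (1/(mn)) Σ_i Σ_j ‖x_i − y_j‖². In particular this quantity is zero if and only if the two sample means coincide. -/
theorem double_sum_norm_sub {H : Type*} [NormedAddCommGroup H]
    [InnerProductSpace ℝ H] {p q : ℕ} (a : Fin p → H) (b : Fin q → H) :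
    ∑ i, ∑ j, ‖a i - b j‖ ^ 2 = (q : ℝ) * ∑ i, ‖a i‖ ^ 2
      - 2 * inner ℝ (∑ i, a i) (∑ j, b j) + (p : ℝ) * ∑ j, ‖b j‖ ^ 2 := by
  simp only [norm_sub_sq_real, Finset.sum_add_distrib, Finset.sum_sub_distrib, sum_inner,
    inner_sum, Finset.mul_sum, Finset.sum_const, Finset.card_univ, Fintype.card_fin,
    nsmul_eq_mul]
  congr 2
  exact Finset.sum_comm


/-- In a real inner product space, `2 d₂(A,B) − d₂(A,A) − d₂(B,B) = 2‖x̄ − ȳ‖²`, where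
`d₂(A,B) = (1/(mn)) ∑_i ∑_j ‖x_i − y_j‖²`; in particular this quantity vanishes if and
only if the two sample means coincide. -/
theorem between_dispersion_eq_mean_diff {H : Type*} [NormedAddCommGroup H]
    [InnerProductSpace ℝ H] {m n : ℕ} (hm : 0 < m) (hn : 0 < n)
    (x : Fin m → H) (y : Fin n → H) :
    (2 * ((1 / ((m : ℝ) * (n : ℝ))) * ∑ i, ∑ j, ‖x i - y j‖ ^ 2)
        - (1 / ((m : ℝ) * (m : ℝ))) * ∑ i, ∑ i', ‖x i - x i'‖ ^ 2
        - (1 / ((n : ℝ) * (n : ℝ))) * ∑ j, ∑ j', ‖y j - y j'‖ ^ 2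
      = 2 * ‖(1 / (m : ℝ)) • ∑ i, x i - (1 / (n : ℝ)) • ∑ j, y j‖ ^ 2)
    ∧ (2 * ((1 / ((m : ℝ) * (n : ℝ))) * ∑ i, ∑ j, ‖x i - y j‖ ^ 2)
        - (1 / ((m : ℝ) * (m : ℝ))) * ∑ i, ∑ i', ‖x i - x i'‖ ^ 2
        - (1 / ((n : ℝ) * (n : ℝ))) * ∑ j, ∑ j', ‖y j - y j'‖ ^ 2 = 0
      ↔ (1 / (m : ℝ)) • ∑ i, x i = (1 / (n : ℝ)) • ∑ j, y j) := by
  have hm' : (m : ℝ) ≠ 0 := by positivity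
  have hn' : (n : ℝ) ≠ 0 := by positivity
  rw [← sub_eq_zero (a := (1 / (m : ℝ)) • ∑ i, x i)]
  refine and_iff_left_of_imp (fun h => ?_) |>.mpr ?_
  rotate_left
  · rw [double_sum_norm_sub, double_sum_norm_sub, double_sum_norm_sub, norm_sub_sq_real,
      norm_smul, norm_smul, real_inner_smul_left, real_inner_smul_right,
      real_inner_self_eq_norm_sq, real_inner_self_eq_norm_sq, mul_pow, mul_pow,
      Real.norm_eq_abs, Real.norm_eq_abs, sq_abs, sq_abs]
    field_simp
    ring
  · rw [h]
    simp
end
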